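/- arXiv:2206.00413 — 8 statements merged into one kernel-verified Lean document; each statement's English description precedes it below -/
import Mathlib

section
/- Let k ≥ 2 be an integer, let U_1,…,U_k be subsets of ℕ with |U_i| ≥ k for each i ∈ {1,…,k}, and let X be the set of accumulation points of D^\underline{k}(U_1,…,U_k). Then for every x ∈ X and every subset I ⊆ {1,…,k} that meets x, the point ρ_I(x) belongs to X. -/
open Set Filter Topology

noncomputable def rho {k : ℕ} (u : Fin k → ℝ) : EuclideanSpace ℝ (Fin k) :=
  ‖((EuclideanSpace.equiv (Fin k) ℝ).symm u : EuclideanSpace ℝ (Fin k))‖⁻¹ •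
    ((EuclideanSpace.equiv (Fin k) ℝ).symm u)

def unitSphere (k : ℕ) : Set (EuclideanSpace ℝ (Fin k)) :=
  {x | ‖x‖ = 1 ∧ ∀ i, x i ∈ Icc (0:ℝ) 1}

def genDir (k : ℕ) (U : Fin k → Set ℕ) : Set (EuclideanSpace ℝ (Fin k)) :=
  {y | ∃ u : Fin k → ℕ, (∀ i, u i ∈ U i) ∧ y = rho (fun i => (u i : ℝ))}

def genDirDistinct (k : ℕ) (U : Fin k → Set ℕ) : Set (EuclideanSpace ℝ (Fin k)) :=
  {y | ∃ u : Fin k → ℕ, (∀ i, u i ∈ U i) ∧ (∀ i j, i ≠ j → u i ≠ u j) ∧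
    y = rho (fun i => (u i : ℝ))}

def dirSet (k : ℕ) (A : Set ℕ) : Set (EuclideanSpace ℝ (Fin k)) :=
  {y | ∃ u : Fin k → ℕ, (∀ i, u i ∈ A) ∧ y = rho (fun i => (u i : ℝ))}

def accSet {α : Type*} [TopologicalSpace α] (Y : Set α) : Set α := {x | AccPt x (𝓟 Y)}


lemma rho_apply {k : ℕ} (u : Fin k → ℝ) (i : Fin k) :
    rho u i = ‖(WithLp.toLp 2 u : EuclideanSpace ℝ (Fin k))‖⁻¹ * u i := by
  rfl

lemma rho_smul {k : ℕ} (c : ℝ) (hc : 0 < c) (u : Fin k → ℝ) : rho (fun i => c * u i) = rho u := by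
  have h : (WithLp.toLp 2 (fun i => c * u i) : EuclideanSpace ℝ (Fin k)) = c • WithLp.toLp 2 u := rfl
  ext i
  rw [rho_apply, rho_apply, h, norm_smul, Real.norm_of_nonneg hc.le, mul_inv]
  field_simp

lemma rho_cont {k : ℕ} (u : Fin k → ℝ) (hu : u ≠ 0) : ContinuousAt (rho (k := k)) u := by
  have hn : ‖((EuclideanSpace.equiv (Fin k) ℝ).symm u : EuclideanSpace ℝ (Fin k))‖ ≠ 0 := by
    rw [norm_ne_zero_iff]
    simpa using hu
  have hc : ContinuousAt (fun u => (EuclideanSpace.equiv (Fin k) ℝ).symm u) u :=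
    (EuclideanSpace.equiv (Fin k) ℝ).symm.continuous.continuousAt
  exact (hc.norm.inv₀ hn).smul hc

lemma exists_choice (k : ℕ) (U : Fin k → Set ℕ)
    (hcard : ∀ i, ∃ s : Finset ℕ, ↑s ⊆ U i ∧ s.card = k) :
    ∃ c : Fin k → ℕ, Function.Injective c ∧ ∀ i, c i ∈ U i := by
  choose t ht htc using hcard
  obtain ⟨c, hc, hct⟩ := (Finset.all_card_le_biUnion_card_iff_exists_injective t).1 (by
    intro s
    rcases s.eq_empty_or_nonempty with rfl | ⟨a, ha⟩
    · simp
    · calc s.card ≤ k := by simpa using s.card_le_univ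
        _ = (t a).card := (htc a).symm
        _ ≤ _ := Finset.card_le_card (Finset.subset_biUnion_of_mem t ha))
  exact ⟨c, hc, fun i => ht i (hct i)⟩

lemma norm_tendsto (k : ℕ) : Tendsto (fun u : Fin k → ℕ =>
    ‖(WithLp.toLp 2 (fun i => (u i : ℝ)) : EuclideanSpace ℝ (Fin k))‖) cofinite atTop := by
  rw [tendsto_atTop]
  intro M
  rw [eventually_cofinite]
  refine (Set.finite_Iic (fun _ : Fin k => ⌈M⌉₊)).subset ?_
  intro u hu i
  simp only [mem_setOf_eq, not_le] at hu
  have h := PiLp.norm_apply_le (WithLp.toLp 2 (fun i => (u i : ℝ)) : EuclideanSpace ℝ (Fin k)) i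
  have h2 : ((u i : ℕ) : ℝ) ≤ M := by
    simp only [Real.norm_natCast] at h
    linarith
  exact_mod_cast h2.trans (Nat.le_ceil M)

/-- If each U_i has at least k elements, then the set of accumulation
points X of the distinct k-generalized direction set satisfies: for every x ∈ X and
every index set I meeting x (i.e. x_i ≠ 0 for some i ∈ I), the point ρ_I(x) ∈ X,
where ρ_I(x) = ρ(y) with y_i = x_i for i ∈ I and y_i = 0 otherwise. -/
theorem stmt_2 (k : ℕ) (hk : 2 ≤ k) (U : Fin k → Set ℕ)
    (hpos : ∀ i, ∀ u ∈ U i, 0 < u)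
    (hcard : ∀ i, ∃ s : Finset ℕ, ↑s ⊆ U i ∧ s.card = k)
    (x : EuclideanSpace ℝ (Fin k)) (hx : x ∈ accSet (genDirDistinct k U))
    (I : Set (Fin k)) [DecidablePred (· ∈ I)] (hI : ∃ i ∈ I, x i ≠ 0) :
    rho (fun i => if i ∈ I then x i else 0) ∈ accSet (genDirDistinct k U) := by
  classical
  obtain ⟨c, hcinj, hcU⟩ := exists_choice k U hcard
  let S : Set (Fin k → ℕ) := {u | (∀ i, u i ∈ U i) ∧ (∀ i j, i ≠ j → u i ≠ u j)}
  let R : (Fin k → ℕ) → EuclideanSpace ℝ (Fin k) := fun u => rho (fun i => (u i : ℝ))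
  let N : (Fin k → ℕ) → ℝ := fun u =>
    ‖(WithLp.toLp 2 (fun i => (u i : ℝ)) : EuclideanSpace ℝ (Fin k))‖
  let F : Filter (Fin k → ℕ) := comap R (𝓝[≠] x) ⊓ 𝓟 S
  have hx' : ∃ᶠ y in 𝓝[≠] x, y ∈ genDirDistinct k U := by
    have : AccPt x (𝓟 (genDirDistinct k U)) := hx
    rw [accPt_iff_frequently_nhdsNE] at this
    exact this
  haveI hF : F.NeBot := by
    rw [← frequently_mem_iff_neBot]
    rw [Filter.frequently_comap]
    refine hx'.mono ?_
    rintro y ⟨u, h1, h2, rfl⟩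
    exact ⟨u, rfl, h1, h2⟩
  have hR' : Tendsto R F (𝓝[≠] x) := tendsto_comap.mono_left inf_le_left
  have hR : Tendsto R F (𝓝 x) := hR'.mono_right nhdsWithin_le_nhds
  have hS : ∀ᶠ u in F, u ∈ S := mem_inf_of_right (mem_principal_self S)
  have hcof : F ≤ cofinite := by
    rw [le_cofinite_iff_eventually_ne]
    intro u0
    have : ∀ᶠ y in 𝓝[≠] x, y ≠ R u0 := by
      by_cases h : R u0 = x
      · rw [h]; exact self_mem_nhdsWithin
      · exact nhdsWithin_le_nhds (eventually_ne_nhds (Ne.symm h))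
    filter_upwards [hR'.eventually this] with u hu h
    exact hu (by rw [h])
  have hN : Tendsto N F atTop := (norm_tendsto k).mono_left hcof
  have hNpos : ∀ᶠ u in F, 0 < N u := hN.eventually_gt_atTop 0
  have hRi : ∀ i, Tendsto (fun u => R u i) F (𝓝 (x i)) := fun i =>
    ((EuclideanSpace.proj (𝕜 := ℝ) i).continuous.tendsto x).comp hR
  have hx0 : ∀ i, 0 ≤ x i := fun i => ge_of_tendsto' (hRi i) (fun u => by
    show 0 ≤ rho _ i
    rw [rho_apply]
    positivity)
  by_cases hIu : ∀ i, i ∈ I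
  · have hnorm : ‖x‖ = 1 := by
      refine tendsto_nhds_unique hR.norm (tendsto_const_nhds.congr' ?_)
      filter_upwards [hNpos] with u hu
      have : R u = (N u)⁻¹ • (WithLp.toLp 2 (fun i => (u i : ℝ)) : EuclideanSpace ℝ (Fin k)) := rfl
      rw [this, norm_smul, norm_inv, Real.norm_of_nonneg hu.le]
      exact (inv_mul_cancel₀ hu.ne').symm
    have : rho (fun i => if i ∈ I then x i else 0) = x := by
      ext i
      have h2 : (WithLp.toLp 2 (fun i => if i ∈ I then x i else 0) : EuclideanSpace ℝ (Fin k)) = x := by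
        ext j; simp [hIu]
      rw [rho_apply, h2, hnorm]
      simp [hIu]
    rw [this]; exact hx
  · push Not at hIu
    obtain ⟨i0, hi0⟩ := hIu
    let J : Set (Fin k) := {i | i ∈ I ∧ x i ≠ 0}
    let z : Fin k → ℝ := fun i => if i ∈ I then x i else 0
    let v : (Fin k → ℕ) → Fin k → ℕ := fun u i => if i ∈ J then u i else c i
    have hJ : ∀ i ∈ J, Tendsto (fun u : Fin k → ℕ => u i) F atTop := by
      intro i hi
      rw [← tendsto_natCast_atTop_iff (R := ℝ)]
      have hpos' : 0 < x i := lt_of_le_of_ne (hx0 i) (Ne.symm hi.2)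
      refine (hN.atTop_mul_pos hpos' (hRi i)).congr' ?_
      filter_upwards [hNpos] with u hu
      show N u * rho _ i = _
      rw [rho_apply]
      exact mul_inv_cancel_left₀ hu.ne' _
    have hz : z ≠ 0 := by
      obtain ⟨i, hi, hxi⟩ := hI
      intro h
      have := congrFun h i
      simp [z, hi, hxi] at this
    have hlim : Tendsto (fun u i => (N u)⁻¹ * (v u i : ℝ)) F (𝓝 z) := by
      rw [tendsto_pi_nhds]
      intro i
      by_cases hi : i ∈ J
      · have : z i = x i := by simp [z, hi.1]
        rw [this]
        refine (hRi i).congr (fun u => ?_)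
        simp only [v, if_pos hi]
        exact rho_apply _ i
      · have : z i = 0 := by
          by_cases h : i ∈ I
          · have : x i = 0 := by by_contra h'; exact hi ⟨h, h'⟩
            simp [z, this]
          · simp [z, h]
        rw [this]
        simp only [v, if_neg hi]
        simpa using hN.inv_tendsto_atTop.mul_const (c i : ℝ)
    have hlimR : Tendsto (fun u => R (v u)) F (𝓝 (rho z)) := by
      refine ((rho_cont z hz).tendsto.comp hlim).congr' ?_
      filter_upwards [hNpos] with u hu
      exact rho_smul _ (inv_pos.2 hu) _
    have hvalid : ∀ᶠ u in F, v u ∈ S := by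
      have hbig : ∀ᶠ u in F, ∀ i, i ∈ J → ∀ j, c j < u i := by
        rw [eventually_all]
        intro i
        by_cases hi : i ∈ J
        · have : ∀ᶠ u in F, ∀ j, c j < u i :=
            eventually_all.2 (fun j => (hJ i hi).eventually_gt_atTop (c j))
          exact this.mono (fun u h _ => h)
        · exact Eventually.of_forall (fun u h => absurd h hi)
      filter_upwards [hbig, hS] with u hb hu
      refine ⟨fun i => ?_, fun i j hij => ?_⟩
      · by_cases hi : i ∈ J
        · simpa only [v, if_pos hi] using hu.1 i
        · simpa only [v, if_neg hi] using hcU i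
      · by_cases hi : i ∈ J <;> by_cases hj : j ∈ J
        · simpa only [v, if_pos hi, if_pos hj] using hu.2 i j hij
        · simpa only [v, if_pos hi, if_neg hj] using (hb i hi j).ne'
        · simpa only [v, if_neg hi, if_pos hj] using (hb j hj i).ne
        · simpa only [v, if_neg hi, if_neg hj] using hcinj.ne hij
    show AccPt _ _
    rw [accPt_iff_frequently]
    refine hlimR.frequently (Eventually.frequently ?_)
    filter_upwards [hvalid] with u hu
    refine ⟨fun h => ?_, v u, hu.1, hu.2, rfl⟩
    have h0 : R (v u) i0 = 0 := by
      rw [h, rho_apply]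
      simp [z, hi0]
    have hvpos : (0 : ℝ) < v u i0 := by exact_mod_cast hpos i0 _ (hu.1 i0)
    have hnp : 0 < ‖(WithLp.toLp 2 (fun i => (v u i : ℝ)) : EuclideanSpace ℝ (Fin k))‖ := by
      rw [norm_pos_iff]
      intro h'
      have := congrArg (fun y : EuclideanSpace ℝ (Fin k) => y i0) h'
      exact hvpos.ne' this
    have h1 : 0 < R (v u) i0 := by
      show 0 < rho _ i0
      rw [rho_apply]
      exact mul_pos (inv_pos.2 hnp) hvpos
    exact h1.ne' h0
end

section
/- Let k ≥ 2 be an integer and let U_1,…,U_k ⊆ ℕ be such that the natural density d(U_i) exists and equals δ_i > 0 for all i = 1,…,k. Assume that the intersection U_1 ∩ ⋯ ∩ U_k is an infinite set. Then D^k(U_1,…,U_k) is dense in S^{k-1}. -/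
open Set Filter Topology

lemma aux_count (U : Set ℕ) (δ : ℝ)
    (h : Tendsto (fun X : ℕ => ((U ∩ Set.Iic X).ncard : ℝ) / X) atTop (𝓝 δ))
    (a : ℝ) (ha : 0 < a) :
    Tendsto (fun n : ℕ => ((U ∩ Set.Iic ⌊a * (n:ℝ)⌋₊).ncard : ℝ) / n) atTop (𝓝 (δ * a)) := by
  have h1 : Tendsto (fun n : ℕ => ⌊a * (n:ℝ)⌋₊) atTop atTop :=
    tendsto_nat_floor_atTop.comp (tendsto_natCast_atTop_atTop.const_mul_atTop ha)
  have h2 : Tendsto (fun n : ℕ => ((⌊a * (n:ℝ)⌋₊ : ℕ) : ℝ) / (n:ℝ)) atTop (𝓝 a) :=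
    (tendsto_nat_floor_mul_div_atTop ha.le).comp tendsto_natCast_atTop_atTop
  have h3 := (h.comp h1).mul h2
  refine h3.congr' ?_
  filter_upwards [h1.eventually_gt_atTop 0, eventually_gt_atTop 0] with n hn hn0
  have : ((⌊a * (n:ℝ)⌋₊ : ℕ) : ℝ) ≠ 0 := by exact_mod_cast hn.ne'
  have : (n : ℝ) ≠ 0 := by exact_mod_cast hn0.ne'
  simp only [Function.comp]
  field_simp

lemma aux_near (U : Set ℕ) (δ : ℝ) (hδ : 0 < δ)
    (h : Tendsto (fun X : ℕ => ((U ∩ Set.Iic X).ncard : ℝ) / X) atTop (𝓝 δ))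
    (y ε : ℝ) (hy : 0 ≤ y) (hε : 0 < ε) :
    ∀ᶠ n : ℕ in atTop, ∃ u ∈ U, |(u : ℝ) / n - y| ≤ ε := by
  have h1 := aux_count U δ h (y + ε / 2) (by positivity)
  have h2 := aux_count U δ h (y + ε) (by positivity)
  have h3 := h1.eventually_lt h2 (by nlinarith)
  filter_upwards [h3, eventually_gt_atTop 0] with n hn hn0
  have hn0' : (0 : ℝ) < n := by exact_mod_cast hn0
  have h4 := (div_lt_div_iff_of_pos_right hn0').1 hn
  have h5 : (U ∩ Set.Iic ⌊(y + ε / 2) * (n:ℝ)⌋₊).ncard < (U ∩ Set.Iic ⌊(y + ε) * (n:ℝ)⌋₊).ncard := by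
    exact_mod_cast h4
  obtain ⟨u, hu, hu'⟩ := Set.exists_mem_notMem_of_ncard_lt_ncard h5
    ((Set.finite_Iic _).subset Set.inter_subset_right)
  refine ⟨u, hu.1, ?_⟩
  have h6 : ⌊(y + ε / 2) * (n:ℝ)⌋₊ < u := by
    by_contra hc
    exact hu' ⟨hu.1, not_lt.1 hc⟩
  have h7 := (Nat.floor_lt (by positivity)).1 h6
  have h8 := (Nat.le_floor_iff (by positivity)).1 hu.2
  have h9 := (lt_div_iff₀ hn0').2 h7
  have h10 := (div_le_iff₀ hn0').2 h8
  rw [abs_le]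
  constructor <;> linarith

lemma aux_rho {k : ℕ} (u : Fin k → ℝ) (c : ℝ) (hc : 0 < c) :
    rho (fun i => u i / c) = rho u := by
  have : (fun i => u i / c) = c⁻¹ • u := by
    ext i; simp [div_eq_inv_mul]
  unfold rho
  rw [this, map_smul, norm_smul, smul_smul, Real.norm_of_nonneg (by positivity)]
  congr 1
  field_simp

theorem stmt_3 (k : ℕ) (hk : 2 ≤ k) (U : Fin k → Set ℕ)
    (hpos : ∀ i, ∀ u ∈ U i, 0 < u)
    (δ : Fin k → ℝ) (hδ : ∀ i, 0 < δ i)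
    (hdens : ∀ i, Tendsto (fun X : ℕ => ((U i ∩ Set.Iic X).ncard : ℝ) / X) atTop (𝓝 (δ i)))
    (hinf : (⋂ i, U i).Infinite) :
    unitSphere k ⊆ closure (genDir k U) := by
  rintro x ⟨hx, hx'⟩
  set v : Fin k → ℝ := EuclideanSpace.equiv (Fin k) ℝ x with hv
  have hvx : (EuclideanSpace.equiv (Fin k) ℝ).symm v = x := by simp [hv]
  have hr : rho v = x := by
    unfold rho
    rw [hvx, hx]; simp
  have hcont : ContinuousAt (rho (k := k)) v := by
    unfold rho
    have hc : ContinuousAt (fun u : Fin k → ℝ =>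
      ((EuclideanSpace.equiv (Fin k) ℝ).symm u : EuclideanSpace ℝ (Fin k))) v :=
      (EuclideanSpace.equiv (Fin k) ℝ).symm.continuous.continuousAt
    exact (hc.norm.inv₀ (by rw [hvx, hx]; simp)).smul hc
  have hcl : v ∈ closure {w : Fin k → ℝ | ∃ n : ℕ, 0 < n ∧ ∃ u : Fin k → ℕ, (∀ i, u i ∈ U i) ∧
      w = fun i => (u i : ℝ) / n} := by
    rw [Metric.mem_closure_iff]
    intro ε hε
    have h1 : ∀ᶠ n : ℕ in atTop, ∀ i, ∃ u ∈ U i, |(u : ℝ) / n - v i| ≤ ε / 2 :=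
      eventually_all.2 fun i => aux_near (U i) (δ i) (hδ i) (hdens i) (v i) (ε / 2)
        (hx' i).1 (by positivity)
    obtain ⟨n, hn, hn0⟩ := (h1.and (eventually_gt_atTop 0)).exists
    choose u hu hu' using hn
    refine ⟨_, ⟨n, hn0, u, hu, rfl⟩, ?_⟩
    refine lt_of_le_of_lt ((dist_pi_le_iff (by positivity : (0:ℝ) ≤ ε / 2)).2 fun i => ?_)
      (half_lt_self hε)
    rw [dist_comm, Real.dist_eq]
    exact hu' i
  have := hcont.continuousWithinAt.mem_closure_image hcl
  rw [hr] at this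
  refine closure_mono ?_ this
  rintro _ ⟨_, ⟨n, hn, u, hu, rfl⟩, rfl⟩
  exact ⟨u, hu, aux_rho (fun i => (u i : ℝ)) n (by exact_mod_cast hn)⟩
end

section
/- Let k ≥ 2 be an integer and let U_1,…,U_k be nonempty subsets of ℕ. If for each i ∈ {1,…,k} there exists a strictly increasing sequence (u_i^{(n)})_{n≥1} of elements of U_i such that lim_{n→∞} u_i^{(n-1)}/u_i^{(n)} = 1, then D^k(U_1,…,U_k) is dense in S^{k-1}. -/
open Set Filter Topology

theorem aux_one (u : ℕ → ℕ) (hmono : StrictMono u)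
    (hlim : Tendsto (fun n => (u n : ℝ) / (u (n + 1) : ℝ)) atTop (𝓝 1)) :
    ∃ g : ℕ → ℕ, Tendsto (fun m : ℕ => (u (g m) : ℝ) / (m : ℝ)) atTop (𝓝 1) := by
  refine ⟨fun m => Nat.findGreatest (fun n => u n ≤ m) m, ?_⟩
  have hg : Tendsto (fun m => Nat.findGreatest (fun n => u n ≤ m) m) atTop atTop := by
    rw [tendsto_atTop]
    intro b
    filter_upwards [eventually_ge_atTop (u b)] with m hm
    exact Nat.le_findGreatest (le_trans (hmono.le_apply) hm) hm
  refine tendsto_of_tendsto_of_tendsto_of_le_of_le' (hlim.comp hg) tendsto_const_nhds ?_ ?_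
  · filter_upwards [eventually_gt_atTop (u 0)] with m hm
    have hlt : m < u (Nat.findGreatest (fun n => u n ≤ m) m + 1) := by
      by_contra h
      have h' : u (Nat.findGreatest (fun n => u n ≤ m) m + 1) ≤ m := not_lt.mp h
      have := Nat.le_findGreatest (P := fun n => u n ≤ m) (le_trans (hmono.le_apply) h') h'
      omega
    have hm0 : (0:ℝ) < m := by exact_mod_cast (Nat.zero_le _).trans_lt hm
    have : (m:ℝ) ≤ u (Nat.findGreatest (fun n => u n ≤ m) m + 1) := by exact_mod_cast hlt.le
    simp only [Function.comp]
    gcongr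
  · filter_upwards [eventually_gt_atTop (u 0)] with m hm
    have hle : u (Nat.findGreatest (fun n => u n ≤ m) m) ≤ m :=
      Nat.findGreatest_spec (P := fun n => u n ≤ m) (Nat.zero_le m) hm.le
    have hm0 : (0:ℝ) < m := by exact_mod_cast (Nat.zero_le _).trans_lt hm
    rw [div_le_one hm0]
    exact_mod_cast hle

theorem aux_two (u : ℕ → ℕ) (hmono : StrictMono u)
    (hlim : Tendsto (fun n => (u n : ℝ) / (u (n + 1) : ℝ)) atTop (𝓝 1)) (a : ℝ) (ha : 0 ≤ a) :
    ∃ g : ℕ → ℕ, Tendsto (fun N : ℕ => (N : ℝ)⁻¹ * (u (g N) : ℝ)) atTop (𝓝 a) := by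
  rcases ha.eq_or_lt with rfl | ha
  · refine ⟨fun _ => 0, ?_⟩
    simpa using (tendsto_inv_atTop_nhds_zero_nat (𝕜 := ℝ)).mul_const (u 0 : ℝ)
  · obtain ⟨g, hg⟩ := aux_one u hmono hlim
    have h1 : Tendsto (fun N : ℕ => a * (N : ℝ)) atTop atTop :=
      tendsto_natCast_atTop_atTop.const_mul_atTop ha
    have h2 : Tendsto (fun N : ℕ => ⌊a * (N : ℝ)⌋₊) atTop atTop :=
      tendsto_nat_floor_atTop.comp h1
    have h3 : Tendsto (fun N : ℕ => (⌊a * (N : ℝ)⌋₊ : ℝ) / (N : ℝ)) atTop (𝓝 a) :=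
      (tendsto_nat_floor_mul_div_atTop ha.le).comp tendsto_natCast_atTop_atTop
    refine ⟨fun N => g ⌊a * (N : ℝ)⌋₊, ?_⟩
    have h4 := (hg.comp h2).mul h3
    rw [one_mul] at h4
    refine h4.congr' ?_
    filter_upwards [h2.eventually_gt_atTop 0] with N hN
    have : ((⌊a * (N : ℝ)⌋₊ : ℕ) : ℝ) ≠ 0 := by exact_mod_cast hN.ne'
    simp only [Function.comp]
    rw [div_mul_div_cancel₀ this, div_eq_inv_mul]

theorem rho_scale {k : ℕ} (c : ℝ) (hc : 0 < c) (v : Fin k → ℝ) :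
    rho (fun i => c * v i) = rho v := by
  have h : (fun i => c * v i) = c • v := rfl
  unfold rho
  rw [h, map_smul, norm_smul, smul_smul, Real.norm_of_nonneg hc.le, mul_inv, mul_right_comm,
    inv_mul_cancel₀ hc.ne', one_mul]

/-- If each U_i contains a strictly increasing sequence whose ratios of
consecutive terms tend to 1, then the k-generalized direction set is dense in S^{k-1}. -/
theorem stmt_4 (k : ℕ) (hk : 2 ≤ k) (U : Fin k → Set ℕ)
    (hpos : ∀ i, ∀ u ∈ U i, 0 < u) (hne : ∀ i, (U i).Nonempty)
    (u : Fin k → ℕ → ℕ) (hmem : ∀ i n, u i n ∈ U i)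
    (hmono : ∀ i, StrictMono (u i))
    (hlim : ∀ i, Tendsto (fun n => (u i n : ℝ) / (u i (n + 1) : ℝ)) atTop (𝓝 1)) :
    unitSphere k ⊆ closure (genDir k U) := by
  rintro x ⟨hx1, hx⟩
  choose g hg using fun i => aux_two (u i) (hmono i) (hlim i) (x i) (hx i).1
  have hv : Tendsto (fun (N : ℕ) (i : Fin k) => (N : ℝ)⁻¹ * (u i (g i N) : ℝ)) atTop
      (𝓝 (fun i => x i)) := tendsto_pi_nhds.mpr hg
  have hE := ((EuclideanSpace.equiv (Fin k) ℝ).symm.continuous.tendsto (fun i => x i)).comp hv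
  have hxe : (EuclideanSpace.equiv (Fin k) ℝ).symm (fun i => x i) = x := rfl
  rw [hxe] at hE
  have hT := (hE.norm.inv₀ (by rw [hx1]; exact one_ne_zero)).smul hE
  rw [hx1, inv_one, one_smul] at hT
  refine mem_closure_of_tendsto hT ?_
  filter_upwards [eventually_gt_atTop 0] with N hN
  refine ⟨fun i => u i (g i N), fun i => hmem i _, ?_⟩
  exact rho_scale ((N : ℝ)⁻¹) (inv_pos.mpr (by exact_mod_cast hN)) (fun i => (u i (g i N) : ℝ))
end

section
/- Let k ≥ 3 be an integer. Then there exists a partition ℕ = A ∪ B ∪ C of the positive integers into three pairwise disjoint nonempty sets such that none of D^k(A), D^k(B), D^k(C) is dense in S^{k-1}. -/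
open Set Filter Topology

theorem aux_log (a b r : ℕ) (ha : Nat.log 2 a % 3 = r) (hb : Nat.log 2 b % 3 = r)
    (h1 : 2 * b < a) (h2 : a < 4 * b) : False := by
  have hb0 : b ≠ 0 := by omega
  have e1 : Nat.log 2 (b * 2) = Nat.log 2 b + 1 := Nat.log_mul_base (by norm_num) hb0
  have e2 : Nat.log 2 (b * 2 * 2) = Nat.log 2 (b * 2) + 1 :=
    Nat.log_mul_base (by norm_num) (by omega)
  have l1 : Nat.log 2 (b * 2) ≤ Nat.log 2 a := Nat.log_mono_right (by omega)
  have l2 : Nat.log 2 a ≤ Nat.log 2 (b * 2 * 2) := Nat.log_mono_right (by omega)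
  omega

theorem rho_coord {k : ℕ} (u : Fin k → ℝ) (i : Fin k) :
    rho u i = ‖((EuclideanSpace.equiv (Fin k) ℝ).symm u : EuclideanSpace ℝ (Fin k))‖⁻¹ * u i := by
  simp [rho]

theorem aux_main (k : ℕ) (hk : 3 ≤ k) (r : ℕ) :
    ¬ (unitSphere k ⊆ closure (dirSet k {n : ℕ | 0 < n ∧ Nat.log 2 n % 3 = r})) := by
  intro hsub
  let i0 : Fin k := ⟨0, by omega⟩
  let i1 : Fin k := ⟨1, by omega⟩
  have hne : i1 ≠ i0 := by simp [i0, i1]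
  let v : Fin k → ℝ := fun i => if i = i0 then 3 else 1
  have hv : ∀ i, 0 < v i := by
    intro i; simp only [v]; split_ifs <;> norm_num
  have hv0 : ((EuclideanSpace.equiv (Fin k) ℝ).symm v : EuclideanSpace ℝ (Fin k)) ≠ 0 := by
    intro h
    have := congrArg (fun x : EuclideanSpace ℝ (Fin k) => x i0) h
    have h2 := hv i0
    simp at this
    linarith
  have hc : 0 < ‖((EuclideanSpace.equiv (Fin k) ℝ).symm v : EuclideanSpace ℝ (Fin k))‖⁻¹ :=
    inv_pos.mpr (norm_pos_iff.mpr hv0)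
  have hnorm : ‖rho v‖ = 1 := by
    rw [rho, norm_smul, norm_inv, norm_norm]
    exact inv_mul_cancel₀ (norm_ne_zero_iff.mpr hv0)
  have hmem : rho v ∈ unitSphere k := by
    refine ⟨hnorm, fun i => ⟨?_, ?_⟩⟩
    · rw [rho_coord]; exact (mul_pos hc (hv i)).le
    · have h := PiLp.norm_apply_le (rho v) i
      rw [hnorm] at h
      exact (le_abs_self _).trans h
  have hopen : IsOpen {x : EuclideanSpace ℝ (Fin k) | 2 * x i1 < x i0 ∧ x i0 < 4 * x i1} := by
    have c0 : Continuous fun x : EuclideanSpace ℝ (Fin k) => x i0 := by fun_prop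
    have c1 : Continuous fun x : EuclideanSpace ℝ (Fin k) => x i1 := by fun_prop
    exact (isOpen_lt (continuous_const.mul c1) c0).inter (isOpen_lt c0 (continuous_const.mul c1))
  have hvU : rho v ∈ {x : EuclideanSpace ℝ (Fin k) | 2 * x i1 < x i0 ∧ x i0 < 4 * x i1} := by
    simp only [mem_ofPred_eq, rho_coord]
    have e0 : v i0 = 3 := by simp [v]
    have e1 : v i1 = 1 := by simp [v, hne]
    rw [e0, e1]
    constructor <;> linarith
  obtain ⟨y, ⟨hy1, hy2⟩, u, hu, rfl⟩ := mem_closure_iff.mp (hsub hmem) _ hopen hvU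
  rw [rho_coord, rho_coord] at hy1 hy2
  have hcu := inv_nonneg.mpr (norm_nonneg
    ((EuclideanSpace.equiv (Fin k) ℝ).symm (fun i => (u i : ℝ)) : EuclideanSpace ℝ (Fin k)))
  have g1 : (2 * u i1 : ℝ) < u i0 := by
    refine lt_of_mul_lt_mul_left ?_ hcu
    linarith
  have g2 : (u i0 : ℝ) < 4 * u i1 := by
    refine lt_of_mul_lt_mul_left ?_ hcu
    linarith
  exact aux_log (u i0) (u i1) r (hu i0).2 (hu i1).2 (by exact_mod_cast g1) (by exact_mod_cast g2)

/-- For every k ≥ 3 there is a partition of the positive integers into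
three pairwise disjoint nonempty sets A, B, C such that none of the k-direction sets
D^k(A), D^k(B), D^k(C) is dense in S^{k-1}. -/
theorem stmt_7 (k : ℕ) (hk : 3 ≤ k) :
    ∃ A B C : Set ℕ, A.Nonempty ∧ B.Nonempty ∧ C.Nonempty ∧
      Disjoint A B ∧ Disjoint B C ∧ Disjoint A C ∧
      A ∪ B ∪ C = {n : ℕ | 0 < n} ∧
      ¬ (unitSphere k ⊆ closure (dirSet k A)) ∧
      ¬ (unitSphere k ⊆ closure (dirSet k B)) ∧
      ¬ (unitSphere k ⊆ closure (dirSet k C)) := by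

  refine ⟨{n : ℕ | 0 < n ∧ Nat.log 2 n % 3 = 0}, {n : ℕ | 0 < n ∧ Nat.log 2 n % 3 = 1},
    {n : ℕ | 0 < n ∧ Nat.log 2 n % 3 = 2}, ⟨1, ?_⟩, ⟨2, ?_⟩, ⟨4, ?_⟩, ?_, ?_, ?_, ?_,
    aux_main k hk 0, aux_main k hk 1, aux_main k hk 2⟩
  · simp
  · have : Nat.log 2 2 = 1 := by simpa using Nat.log_pow (b := 2) (by norm_num) 1
    simp [this]
  · have : Nat.log 2 4 = 2 := by simpa using Nat.log_pow (b := 2) (by norm_num) 2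
    simp [this]
  · rw [Set.disjoint_left]; rintro n ⟨_, h⟩ ⟨_, h'⟩; omega
  · rw [Set.disjoint_left]; rintro n ⟨_, h⟩ ⟨_, h'⟩; omega
  · rw [Set.disjoint_left]; rintro n ⟨_, h⟩ ⟨_, h'⟩; omega
  · ext n
    simp only [mem_union, mem_ofPred_eq]
    omega
end

section
/- Let A := ⋃_{j≥0} [3^j, 2·3^j) ∩ ℕ. Then there is no strictly increasing sequence (a_n)_{n≥1} of elements of A such that lim_{n→∞} a_n/a_{n+1} = 1; in fact, for every strictly increasing sequence (a_n)_{n≥1} in A there are infinitely many indices n with a_n/a_{n+1} < 2/3. -/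
open Filter Topology

/-- For A = ⋃ⱼ [3^j, 2·3^j) ∩ ℕ, every strictly increasing sequence in A
has infinitely many indices n with a_n/a_{n+1} < 2/3; in particular the ratios
a_n/a_{n+1} do not tend to 1. -/
theorem stmt_13 (A : Set ℕ) (hA : A = {n : ℕ | ∃ j : ℕ, 3 ^ j ≤ n ∧ n < 2 * 3 ^ j})
    (a : ℕ → ℕ) (ha : StrictMono a) (hmem : ∀ n, a n ∈ A) :
    (∃ᶠ n in atTop, (a n : ℝ) / (a (n + 1) : ℝ) < 2 / 3) ∧
      ¬ Tendsto (fun n => (a n : ℝ) / (a (n + 1) : ℝ)) atTop (𝓝 1) := by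
  have key : ∃ᶠ n in atTop, (a n : ℝ) / (a (n + 1) : ℝ) < 2 / 3 := by
    rw [frequently_atTop]
    intro N
    subst hA
    obtain ⟨j, hj1, hj2⟩ := hmem N
    have hex : ∃ m, 2 * 3 ^ j ≤ a m := ⟨2 * 3 ^ j, ha.id_le _⟩
    classical
    have hspec := Nat.find_spec hex
    have hmin := fun k => Nat.find_min hex (m := k)
    generalize Nat.find hex = m at hspec hmin
    have hNm : N < m := by
      by_contra h
      have := ha.monotone (not_lt.mp h)
      omega
    obtain ⟨n, rfl⟩ : ∃ n, m = n + 1 := ⟨m - 1, by omega⟩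
    have h1 : a n < 2 * 3 ^ j := not_le.mp (hmin n (by omega))
    obtain ⟨k, hk1, hk2⟩ := hmem (n + 1)
    have hjk : j < k := by
      by_contra h
      have : 3 ^ k ≤ 3 ^ j := Nat.pow_le_pow_right (by norm_num) (not_lt.mp h)
      omega
    have h3 : 3 ^ (j + 1) ≤ 3 ^ k := Nat.pow_le_pow_right (by norm_num) hjk
    have h4 : 3 * a n < 2 * a (n + 1) := by
      rw [pow_succ] at h3
      omega
    refine ⟨n, by omega, ?_⟩
    have hpos : (0 : ℝ) < a (n + 1) := by
      have : 0 < a (n + 1) := by omega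
      exact_mod_cast this
    have h5 : (3 : ℝ) * a n < 2 * a (n + 1) := by exact_mod_cast h4
    rw [div_lt_div_iff₀ hpos (by norm_num)]
    linarith
  refine ⟨key, fun h => ?_⟩
  have h2 : ∀ᶠ n in atTop, (2 / 3 : ℝ) < (a n : ℝ) / (a (n + 1) : ℝ) :=
    h.eventually (lt_mem_nhds (by norm_num))
  obtain ⟨n, hn1, hn2⟩ := (key.and_eventually h2).exists
  exact lt_asymm hn1 hn2
end

section
/- Let K ⊆ ℝ be a number field of degree d ≥ 3 over ℚ. Then the set O_K^0 := {α ∈ O_K : Tr_{K/ℚ}(α) = 0}, regarded as a subset of ℝ, is dense in ℝ. -/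
open NumberField

/-- If K ⊆ ℝ is a number field of degree d ≥ 3 over ℚ, then the set of
real numbers that are trace-zero algebraic integers of K is dense in ℝ. -/
theorem stmt_15 (K : Subfield ℝ) [FiniteDimensional ℚ K]
    (hd : 3 ≤ Module.finrank ℚ K) :
    Dense {x : ℝ | ∃ α : 𝓞 K, Algebra.trace ℚ K (α : K) = 0 ∧ ((α : K) : ℝ) = x} := by
  let S : AddSubgroup ℝ :=
    { carrier := {x : ℝ | ∃ α : 𝓞 K, Algebra.trace ℚ K (α : K) = 0 ∧ ((α : K) : ℝ) = x}
      zero_mem' := ⟨0, by simp, by simp⟩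
      add_mem' := by
        rintro x y ⟨α, h1, h2⟩ ⟨β, h3, h4⟩
        exact ⟨α + β, by
          change Algebra.trace ℚ K ((α : K) + (β : K)) = 0
          rw [map_add, h1, h3, add_zero], by rw [← h2, ← h4]; rfl⟩
      neg_mem' := by
        rintro x ⟨α, h1, h2⟩
        exact ⟨-α, by
          change Algebra.trace ℚ K (-(α : K)) = 0
          rw [map_neg, h1, neg_zero], by rw [← h2]; rfl⟩ }
  rcases S.dense_or_cyclic with h | ⟨a, ha⟩
  · exact h
  exfalso
  have haS : a ∈ S := by rw [ha]; exact AddSubgroup.mem_closure_singleton_self a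
  obtain ⟨α, -, hα⟩ := haS
  have hker : LinearMap.ker (Algebra.trace ℚ K) ≤ Submodule.span ℚ {(α : K)} := by
    intro k hk
    rw [LinearMap.mem_ker] at hk
    obtain ⟨m, hm, hint⟩ :=
      ((IsFractionRing.isAlgebraic_iff ℤ ℚ K).2
        (IsAlgebraic.of_finite ℚ k)).exists_integral_multiple
    have hmem : ((m • k : K) : ℝ) ∈ S :=
      ⟨⟨m • k, hint⟩, by
        change Algebra.trace ℚ K (m • k) = 0
        rw [map_zsmul, hk, smul_zero], rfl⟩
    rw [ha, AddSubgroup.mem_closure_singleton] at hmem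
    obtain ⟨n, hn⟩ := hmem
    have e : n • (α : K) = m • k := by
      apply Subtype.ext
      rw [← hn, ← hα]
      simp
    rw [Submodule.mem_span_singleton]
    refine ⟨(n : ℚ) / m, ?_⟩
    have hm' : (m : K) ≠ 0 := by exact_mod_cast hm
    rw [Algebra.smul_def]
    simp only [zsmul_eq_mul] at e
    simp only [map_div₀, map_intCast]
    rw [div_mul_eq_mul_div, e]
    field_simp
  have h1 := Submodule.finrank_mono hker
  have h2 : Module.finrank ℚ (Submodule.span ℚ {(α : K)}) ≤ 1 := by
    simpa using finrank_span_le_card (R := ℚ) ({(α : K)} : Set K)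
  have h3 := LinearMap.finrank_range_add_finrank_ker (Algebra.trace ℚ K)
  have h4 := Submodule.finrank_le (LinearMap.range (Algebra.trace ℚ K))
  rw [Module.finrank_self] at h4
  omega
end

section
/- Let ω(n) denote the number of distinct prime divisors of n and, for a real number X > 0, let ω_X := #{n ≤ X : n = k·ω(k) for some k ∈ ℕ}. Then ω_X = X/log log X + o(X/log log X) as X → ∞. -/
open Filter Topology

namespace OmegaX

open Finset

/-- the number of distinct prime factors -/
noncomputable def om (n : ℕ) : ℕ := n.primeFactors.card

noncomputable def C₀ : ℝ := Real.log 4 + 4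

lemma C₀_pos : 0 < C₀ := by
  have := Real.log_nonneg (show (1:ℝ) ≤ 4 by norm_num)
  unfold C₀; linarith

lemma psi_nat (N : ℕ) : ∑ d ∈ Ioc 0 N, ArithmeticFunction.vonMangoldt d ≤ C₀ * N := by
  have := Chebyshev.psi_le_const_mul_self (x := (N:ℝ)) (by positivity)
  simpa [Chebyshev.psi, C₀] using this

lemma sum_log (N : ℕ) : ∑ n ∈ Ioc 0 N, Real.log n
    = ∑ d ∈ Ioc 0 N, ArithmeticFunction.vonMangoldt d * ((N / d : ℕ) : ℝ) := by
  rw [← ArithmeticFunction.sum_Ioc_mul_zeta_eq_sum, ArithmeticFunction.vonMangoldt_mul_zeta]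
  simp

lemma mertens1_Lambda {N : ℕ} (hN : 0 < N) :
    ∑ d ∈ Ioc 0 N, ArithmeticFunction.vonMangoldt d / d ≤ Real.log N + C₀ := by
  have h1 := sum_log N
  have h2 : ∑ n ∈ Ioc 0 N, Real.log n ≤ N * Real.log N := by
    calc _ ≤ ∑ n ∈ Ioc 0 N, Real.log N := by
          apply sum_le_sum
          intro n hn
          simp only [mem_Ioc] at hn
          apply Real.log_le_log (by exact_mod_cast hn.1) (by exact_mod_cast hn.2)
      _ = _ := by simp
  have h3 : ∑ d ∈ Ioc 0 N, ArithmeticFunction.vonMangoldt d * ((N:ℝ) / d - 1) ≤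
     ∑ d ∈ Ioc 0 N, ArithmeticFunction.vonMangoldt d * ((N / d : ℕ) : ℝ) := by
    apply sum_le_sum
    intro d hd
    apply mul_le_mul_of_nonneg_left _ ArithmeticFunction.vonMangoldt_nonneg
    have := Nat.lt_floor_add_one ((N:ℝ)/d)
    rw [Nat.floor_div_eq_div] at this
    linarith
  have h4 : ∑ d ∈ Ioc 0 N, ArithmeticFunction.vonMangoldt d * ((N:ℝ) / d - 1) =
     N * ∑ d ∈ Ioc 0 N, ArithmeticFunction.vonMangoldt d / d - ∑ d ∈ Ioc 0 N, ArithmeticFunction.vonMangoldt d := by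
    rw [mul_sum, ← sum_sub_distrib]
    apply sum_congr rfl
    intros; ring
  have h5 := psi_nat N
  have hN' : (0:ℝ) < N := by exact_mod_cast hN
  have : (N:ℝ) * ∑ d ∈ Ioc 0 N, ArithmeticFunction.vonMangoldt d / d ≤ N * (Real.log N + C₀) := by
    linarith
  exact le_of_mul_le_mul_left this hN'

lemma mertens1 {N : ℕ} (hN : 0 < N) :
    ∑ p ∈ (N+1).primesBelow, Real.log p / p ≤ Real.log N + C₀ := by
  refine le_trans ?_ (mertens1_Lambda hN)
  calc _ = ∑ p ∈ (N+1).primesBelow, ArithmeticFunction.vonMangoldt p / p := by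
        apply sum_congr rfl
        intro p hp
        rw [ArithmeticFunction.vonMangoldt_apply_prime (Nat.prime_of_mem_primesBelow hp)]
    _ ≤ _ := by
        apply sum_le_sum_of_subset_of_nonneg
        · intro p hp
          have := Nat.mem_primesBelow.1 hp
          simp only [mem_Ioc]
          exact ⟨this.2.pos, by omega⟩
        · intros
          exact div_nonneg ArithmeticFunction.vonMangoldt_nonneg (by positivity)

noncomputable def P (N : ℕ) : ℝ := ∑ p ∈ (N+1).primesBelow, (1:ℝ) / p

lemma P_ind {N : ℕ} (hN : 2 ≤ N) :
    P N ≤ (∑ p ∈ (N+1).primesBelow, Real.log p / p) / Real.log N + Real.log (Real.log N)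
      - Real.log (Real.log 2) + C₀ * (1 / Real.log 2 - 1 / Real.log N) := by
  induction N, hN using Nat.le_induction with
  | base =>
    have : Nat.primesBelow (2+1) = {2} := by decide
    have h2 : Real.log 2 ≠ 0 := (Real.log_pos (by norm_num)).ne'
    rw [P, this]
    simp
    field_simp
    rfl
  | succ N hN ih =>
    have hlN : 0 < Real.log N := Real.log_pos (by exact_mod_cast hN)
    have hlN1 : 0 < Real.log ((N+1 : ℕ):ℝ) := Real.log_pos (by exact_mod_cast (by omega))
    have hle : Real.log N ≤ Real.log ((N+1 : ℕ):ℝ) :=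
      Real.log_le_log (by exact_mod_cast (by omega)) (by push_cast; linarith)
    have hm := mertens1 (N := N) (by omega)
    set A := ∑ p ∈ (N+1).primesBelow, Real.log p / p with hA
    have hlog : 1 - Real.log N / Real.log ((N+1 : ℕ):ℝ) ≤
        Real.log (Real.log ((N+1 : ℕ):ℝ)) - Real.log (Real.log N) := by
      have := Real.one_sub_inv_le_log_of_pos (x := Real.log ((N+1 : ℕ):ℝ) / Real.log N) (by positivity)
      rwa [Real.log_div hlN1.ne' hlN.ne', inv_div] at this
    set a := Real.log N
    set b := Real.log ((N+1 : ℕ):ℝ)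
    have key : A * (1/a - 1/b) ≤ (Real.log b - Real.log a) + C₀ * (1/a-1/b) := by
      have hd : 0 ≤ 1/a - 1/b := by
        have := one_div_le_one_div_of_le hlN hle
        linarith
      have := mul_le_mul_of_nonneg_right hm hd
      have e : (a + C₀) * (1/a-1/b) = 1 - a / b + C₀ * (1/a-1/b) := by
        field_simp
      linarith
    by_cases hp : (N+1).Prime
    · have e1 : P (N+1) = P N + 1 / ((N+1:ℕ):ℝ) := by
        rw [P, Nat.primesBelow_succ, if_pos hp, sum_insert (by simp [Nat.primesBelow]), P]; ring
      have e2 : ∑ p ∈ (N+1+1).primesBelow, Real.log p / p = A + b / ((N+1:ℕ):ℝ) := by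
        rw [Nat.primesBelow_succ, if_pos hp, sum_insert (by simp [Nat.primesBelow])]; ring
      rw [e1, e2]
      have e3 : (A + b / ((N+1:ℕ):ℝ)) / b = A * (1 / b) + 1 / ((N+1:ℕ):ℝ) := by
        field_simp
      rw [e3]
      have e4 : A / a = A * (1/a) := by ring
      rw [e4] at ih
      linarith
    · have e1 : P (N+1) = P N := by
        rw [P, Nat.primesBelow_succ, if_neg hp, P]
      have e2 : ∑ p ∈ (N+1+1).primesBelow, Real.log p / p = A := by
        rw [Nat.primesBelow_succ, if_neg hp]
      rw [e1, e2]
      have e4 : A / a = A * (1/a) := by ring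
      have e5 : A / b = A * (1/b) := by ring
      rw [e4] at ih
      rw [e5]
      linarith

lemma mertens2 : ∃ C : ℝ, 0 ≤ C ∧ ∀ X : ℝ, 3 ≤ X → P ⌊X⌋₊ ≤ Real.log (Real.log X) + C := by
  refine ⟨max 0 (1 - Real.log (Real.log 2) + C₀ / Real.log 2), le_max_left _ _, ?_⟩
  intro X hX
  have hN : 2 ≤ ⌊X⌋₊ := Nat.le_floor (by norm_num; linarith)
  have h := P_ind hN
  have hm := mertens1 (N := ⌊X⌋₊) (by omega)
  set N := ⌊X⌋₊
  have hlN : 0 < Real.log N := Real.log_pos (by exact_mod_cast hN)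
  have hNX : (N:ℝ) ≤ X := Nat.floor_le (by linarith)
  have hle : Real.log N ≤ Real.log X :=
      Real.log_le_log (by exact_mod_cast (by omega)) hNX
  have hlle := Real.log_le_log hlN hle
  have h3 : (∑ p ∈ (N+1).primesBelow, Real.log p / p) / Real.log N ≤ 1 + C₀ * (1/Real.log N) := by
    rw [div_le_iff₀ hlN]
    have : (1 + C₀ * (1/Real.log N)) * Real.log N = Real.log N + C₀ := by field_simp
    linarith
  have := le_max_right 0 (1 - Real.log (Real.log 2) + C₀ / Real.log 2)
  have e : C₀ / Real.log 2 = C₀ * (1 / Real.log 2) := by ring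
  linarith

/-- upper exponential moment -/
lemma moment_up (N : ℕ) (w : ℝ) (hw : 0 ≤ w) :
    ∑ k ∈ Ioc 0 N, (1 + w) ^ om k ≤ N * Real.exp (w * P N) := by
  have h1 : ∀ k ∈ Ioc 0 N, (1 + w) ^ om k =
      ∑ T ∈ ((N+1).primesBelow).powerset, if (∏ p ∈ T, p) ∣ k then w ^ T.card else 0 := by
    intro k hk
    simp only [mem_Ioc] at hk
    rw [om, ← prod_const, prod_one_add, ← sum_filter]
    have : k.primeFactors.powerset = {T ∈ ((N+1).primesBelow).powerset | (∏ p ∈ T, p) ∣ k} := by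
      ext T
      simp only [mem_powerset, mem_filter]
      constructor
      · intro hT
        refine ⟨fun p hp => ?_, ?_⟩
        · have := hT hp
          rw [Nat.mem_primeFactors] at this
          exact Nat.mem_primesBelow.2 ⟨by have := Nat.le_of_dvd hk.1 this.2.1; omega, this.1⟩
        · exact (prod_dvd_prod_of_subset _ _ _ hT).trans (Nat.prod_primeFactors_dvd k)
      · rintro ⟨hT, hd⟩ p hp
        rw [Nat.mem_primeFactors]
        exact ⟨Nat.prime_of_mem_primesBelow (hT hp), (dvd_prod_of_mem _ hp).trans hd, by omega⟩
    rw [this]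
    apply sum_congr rfl
    intros; simp
  rw [sum_congr rfl h1, sum_comm]
  have h2 : ∀ T ∈ ((N+1).primesBelow).powerset,
      (∑ k ∈ Ioc 0 N, if (∏ p ∈ T, p) ∣ k then w ^ T.card else 0) ≤ N * ∏ p ∈ T, (w / p) := by
    intro T hT
    rw [← sum_filter, sum_const, nsmul_eq_mul, Nat.Ioc_filter_dvd_card_eq_div, prod_div_distrib,
      prod_const]
    have : ((N / (∏ p ∈ T, p) : ℕ) : ℝ) ≤ N / (∏ p ∈ T, (p:ℝ)) := by
      have := @Nat.cast_div_le ℝ _ _ _ N (∏ p ∈ T, p)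
      push_cast at this
      exact this
    calc _ ≤ N / (∏ p ∈ T, (p:ℝ)) * w ^ T.card := by gcongr
      _ = _ := by ring
  refine (sum_le_sum h2).trans ?_
  rw [← mul_sum, ← prod_one_add]
  gcongr
  calc ∏ i ∈ (N + 1).primesBelow, (1 + w / i) ≤ ∏ i ∈ (N + 1).primesBelow, Real.exp (w / i) := by
        apply Finset.prod_le_prod
        · intros; positivity
        · intro i _
          have := Real.add_one_le_exp (w / i)
          linarith
    _ = _ := by
        rw [← Real.exp_sum, P, mul_sum]
        congr 1
        apply sum_congr rfl; intros; ring

lemma om_mul_le {a b : ℕ} (ha : a ≠ 0) (hb : b ≠ 0) : om (a * b) ≤ om a + om b := by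
  rw [om, Nat.primeFactors_mul ha hb]
  exact card_union_le _ _

lemma om_le_mul {a b : ℕ} (ha : a ≠ 0) (hb : b ≠ 0) : om a ≤ om (a * b) := by
  rw [om, om, Nat.primeFactors_mul ha hb]
  exact card_le_card subset_union_left

lemma two_pow_om {n : ℕ} (hn : n ≠ 0) : 2 ^ om n ≤ n := by
  refine le_trans ?_ (Nat.le_of_dvd (Nat.pos_of_ne_zero hn) (Nat.prod_primeFactors_dvd n))
  rw [om]
  apply pow_card_le_prod
  intro p hp
  exact (Nat.prime_of_mem_primeFactors hp).two_le

noncomputable def g (z : ℝ) : ArithmeticFunction ℝ := ⟨fun n => if n = 0 then 0 else z ^ om n, by simp⟩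

lemma g_apply (z : ℝ) {n : ℕ} (hn : n ≠ 0) : g z n = z ^ om n := by
  simp [g, hn]

lemma moment_low_log (N : ℕ) (z : ℝ) (hz : 0 < z) (hz1 : z ≤ 1) :
    ∑ k ∈ Ioc 0 N, z ^ om k * Real.log k ≤ C₀ * N * ∑ m ∈ Ioc 0 N, z ^ om m / m := by
  calc _ ≤ ∑ k ∈ Ioc 0 N, (g z * ArithmeticFunction.vonMangoldt) k := by
        apply sum_le_sum
        intro k hk
        simp only [mem_Ioc] at hk
        have e := Nat.sum_divisorsAntidiagonal' (n := k)
          (fun _ b => z ^ om k * ArithmeticFunction.vonMangoldt b)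
        rw [← ArithmeticFunction.vonMangoldt_sum, ArithmeticFunction.mul_apply, mul_sum, ← e]
        apply sum_le_sum
        intro x hx
        rw [Nat.mem_divisorsAntidiagonal] at hx
        have hx1 : x.1 ≠ 0 := by rintro h; simp [h] at hx; omega
        have hx2 : x.2 ≠ 0 := by rintro h; simp [h] at hx; omega
        rw [g_apply z hx1]
        apply mul_le_mul_of_nonneg_right _ ArithmeticFunction.vonMangoldt_nonneg
        apply pow_le_pow_of_le_one hz.le hz1
        rw [← hx.1]
        exact om_le_mul hx1 hx2
    _ = ∑ m ∈ Ioc 0 N, g z m * ∑ d ∈ Ioc 0 (N / m), ArithmeticFunction.vonMangoldt d :=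
        ArithmeticFunction.sum_Ioc_mul_eq_sum_sum _ _ _
    _ ≤ ∑ m ∈ Ioc 0 N, z ^ om m * (C₀ * (N / m)) := by
        apply sum_le_sum
        intro m hm
        simp only [mem_Ioc] at hm
        rw [g_apply z (by omega)]
        apply mul_le_mul_of_nonneg_left _ (by positivity)
        refine (psi_nat _).trans ?_
        apply mul_le_mul_of_nonneg_left _ C₀_pos.le
        exact Nat.cast_div_le
    _ = _ := by
        rw [mul_sum]
        apply sum_congr rfl
        intros; ring


lemma om_prime_pow {p : ℕ} (hp : p.Prime) (n : ℕ) : om (p ^ (n+1)) = 1 := by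
  rw [om, Nat.primeFactors_prime_pow (by omega) hp]; simp

lemma tsum_prime {p : ℕ} (hp : p.Prime) (z : ℝ) :
    HasSum (fun n => z ^ om (p ^ n) / ((p ^ n : ℕ) : ℝ)) (1 + z / (p - 1)) := by
  have hp1 : (1:ℝ) < p := by exact_mod_cast hp.one_lt
  rw [← hasSum_nat_add_iff' 1]
  have h := (hasSum_geometric_of_lt_one (r := (1:ℝ)/p) (by positivity)
    (by rw [div_lt_one (by linarith)]; exact hp1)).mul_left (z / p)
  have e : z / p * (1 - (1:ℝ)/p)⁻¹ = 1 + z / (p - 1) - ∑ i ∈ range 1, z ^ om (p ^ i) / ((p ^ i : ℕ) : ℝ) := by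
    have h1 : (p:ℝ) - 1 ≠ 0 := by linarith
    have h2 : (p:ℝ) ≠ 0 := by linarith
    simp [om]
    have h3 : 1 - (p:ℝ)⁻¹ = (p - 1) / p := by field_simp
    rw [h3]
    field_simp
  rw [e] at h
  have e2 : (fun n => z ^ om (p ^ (n+1)) / ((p ^ (n+1) : ℕ) : ℝ)) = fun i => z / p * (1 / p) ^ i := by
    funext n
    rw [om_prime_pow hp]
    push_cast
    rw [pow_succ, one_div_pow]
    field_simp
    ring
  rw [e2]
  exact h

lemma sum_low (N : ℕ) (z : ℝ) (hz : 0 < z) :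
    ∑ m ∈ Ioc 0 N, z ^ om m / m ≤ Real.exp (z * (P N + 2)) := by
  have hE := EulerProduct.summable_and_hasSum_smoothNumbers_prod_primesBelow_tsum
    (f := fun n : ℕ => z ^ om n / (n:ℝ)) (by simp [om])
    (by
      intro m n hmn
      simp only [om]
      rw [hmn.primeFactors_mul, card_union_of_disjoint hmn.disjoint_primeFactors]
      push_cast
      rw [pow_add]
      ring)
    (by
      intro p hp
      exact (tsum_prime hp z).summable.norm) (N+1)
  have h1 : ∑ m ∈ Ioc 0 N, z ^ om m / m ≤ ∏ p ∈ (N+1).primesBelow, ∑' n : ℕ, z ^ om (p ^ n) / ((p ^ n : ℕ) : ℝ) := by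
    have h2 := sum_le_hasSum ((Ioc 0 N).attach.map ⟨fun m => (⟨m.1, by
        have := mem_Ioc.1 m.2
        rw [Nat.mem_smoothNumbers']
        intro p hp hd
        have := Nat.le_of_dvd this.1 hd
        omega⟩ : (N+1).smoothNumbers), by
          intro a b hab
          exact Subtype.ext (congrArg (fun x => x.1) hab)⟩) (fun i _ => by positivity) hE.2
    rw [sum_map] at h2
    rw [← sum_attach]
    exact h2
  refine h1.trans ?_
  have h3 : ∀ p ∈ (N+1).primesBelow, ∑' n : ℕ, z ^ om (p ^ n) / ((p ^ n : ℕ) : ℝ) ≤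
      Real.exp (z / (p - 1)) := by
    intro p hp
    rw [(tsum_prime (Nat.prime_of_mem_primesBelow hp) z).tsum_eq, add_comm]
    exact Real.add_one_le_exp _
  refine (Finset.prod_le_prod (fun p hp => tsum_nonneg fun n => by positivity) h3).trans ?_
  rw [← Real.exp_sum]
  apply Real.exp_le_exp.2
  have h4 : ∀ p ∈ (N+1).primesBelow, z / ((p:ℝ) - 1) ≤ z * (1 / p) + z * (1 / (p-1) - 1/p) := by
    intro p hp
    apply le_of_eq; ring
  refine (sum_le_sum h4).trans ?_
  rw [sum_add_distrib, ← mul_sum, ← mul_sum, mul_add, P]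
  gcongr
  have h5 : ∀ M : ℕ, ∑ n ∈ range M, ((1:ℝ) / (((n + 2:ℕ):ℝ) - 1) - 1 / ((n+2:ℕ):ℝ)) ≤ 1 := by
    intro M
    have : ∀ n : ℕ, ((1:ℝ) / (((n + 2:ℕ):ℝ) - 1) - 1 / ((n+2:ℕ):ℝ)) = (fun k : ℕ => (1:ℝ) / (k+1)) n - (fun k : ℕ => (1:ℝ) / (k+1)) (n+1) := by
      intro n
      push_cast
      congr 2 <;> ring
    rw [sum_congr rfl (fun n _ => this n), sum_range_sub']
    simp
    positivity
  have h6 : ∑ i ∈ (N + 1).primesBelow, (1 / ((i:ℝ) - 1) - 1 / i) ≤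
      ∑ n ∈ range N, ((1:ℝ) / (((n + 2:ℕ):ℝ) - 1) - 1 / ((n+2:ℕ):ℝ)) := by
    rw [← sum_image (s := range N) (g := fun n => n + 2) (f := fun i : ℕ => (1 / ((i:ℝ) - 1) - 1 / i)) (by intro a _ b _ h; simpa using h)]
    apply sum_le_sum_of_subset_of_nonneg
    · intro p hp
      have := Nat.mem_primesBelow.1 hp
      have h2 := this.2.two_le
      simp only [mem_image, mem_range]
      exact ⟨p - 2, by omega, by omega⟩
    · intro i hi _
      simp only [mem_image, mem_range] at hi
      obtain ⟨a, _, rfl⟩ := hi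
      push_cast
      rw [sub_nonneg]
      apply one_div_le_one_div_of_le <;> linarith [(Nat.cast_nonneg a : (0:ℝ) ≤ a)]
  linarith [h5 N]


lemma tail_up : ∃ K : ℝ, 0 ≤ K ∧ ∀ X u : ℝ, 3 ≤ X → 1 ≤ u → Real.log (Real.log X) = u ^ 4 →
    (({k ∈ Ioc 0 ⌊X⌋₊ | u ^ 4 + u ^ 3 ≤ (om k : ℝ)}.card : ℕ) : ℝ) ≤ K * (X * Real.exp (-u ^ 2 / 4)) := by
  obtain ⟨C, hC0, hC⟩ := mertens2
  refine ⟨Real.exp C, by positivity, ?_⟩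
  intro X u hX hu hL
  have hP := hC X hX
  rw [hL] at hP
  set N := ⌊X⌋₊
  set s : ℝ := 1 / (2 * u) with hs
  have hs0 : 0 < s := by positivity
  have hsh : s ≤ 1 / 2 := by
    rw [hs]; apply one_div_le_one_div_of_le <;> linarith
  have hexp := abs_le.1 (Real.abs_exp_sub_one_sub_id_le (x := s) (by rw [abs_of_pos hs0]; linarith))
  have hes : 1 ≤ Real.exp s := Real.one_le_exp hs0.le
  have hm := moment_up N (Real.exp s - 1) (by linarith)
  have h1 : ∑ k ∈ Ioc 0 N with u ^ 4 + u ^ 3 ≤ (om k : ℝ), Real.exp (s * (u ^ 4 + u ^ 3)) ≤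
      ∑ k ∈ Ioc 0 N, (1 + (Real.exp s - 1)) ^ om k := by
    refine le_trans ?_ (sum_le_sum_of_subset_of_nonneg (filter_subset (fun k => u ^ 4 + u ^ 3 ≤ (om k : ℝ)) _)
      (fun i _ _ => by simp; positivity))
    apply sum_le_sum
    intro k hk
    have := (mem_filter.1 hk).2
    rw [add_sub_cancel, ← Real.exp_nat_mul]
    apply Real.exp_le_exp.2
    rw [mul_comm]
    gcongr
  rw [sum_const, nsmul_eq_mul] at h1
  have hNX : (N:ℝ) ≤ X := Nat.floor_le (by linarith)
  have h2 : (N:ℝ) * Real.exp ((Real.exp s - 1) * P N) ≤ X * Real.exp ((s + s ^ 2) * u ^ 4 + C) := by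
    have : (Real.exp s - 1) * P N ≤ (s + s ^ 2) * u ^ 4 + C := by
      calc _ ≤ (Real.exp s - 1) * (u ^ 4 + C) := by gcongr
        _ ≤ (s + s ^ 2) * (u ^ 4 + C) := by gcongr; linarith
        _ = (s + s ^ 2) * u ^ 4 + (s + s ^ 2) * C := by ring
        _ ≤ (s + s ^ 2) * u ^ 4 + 1 * C := by gcongr; nlinarith
        _ = _ := by ring
    gcongr
  have h3 := h1.trans (hm.trans h2)
  have e : (s + s ^ 2) * u ^ 4 + C = (s * (u ^ 4 + u ^ 3)) + (C + (- u ^ 2 / 4)) := by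
    rw [hs]; field_simp; ring
  rw [e, Real.exp_add, Real.exp_add C] at h3
  have hpos := Real.exp_pos (s * (u ^ 4 + u ^ 3))
  refine le_of_mul_le_mul_right (h3.trans (le_of_eq ?_)) hpos
  ring

lemma tail_low : ∃ K : ℝ, 0 ≤ K ∧ ∀ X u : ℝ, 3 ≤ X → 1 ≤ u → Real.log (Real.log X) = u ^ 4 →
    (({k ∈ Ioc 0 ⌊X⌋₊ | (om k : ℝ) ≤ u ^ 4 - u ^ 3}.card : ℕ) : ℝ) ≤
      √X + K * (X * Real.exp (-u ^ 2 / 4)) := by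
  obtain ⟨C, hC0, hC⟩ := mertens2
  refine ⟨2 * C₀ * Real.exp (C + 2), by have := C₀_pos; positivity, ?_⟩
  intro X u hX hu hL
  have hP := hC X hX
  rw [hL] at hP
  have hlogX : Real.log X = Real.exp (u ^ 4) := by
    rw [← hL, Real.exp_log (Real.log_pos (by linarith))]
  set N := ⌊X⌋₊
  set s : ℝ := 1 / (2 * u) with hs
  have hs0 : 0 < s := by positivity
  have hsh : s ≤ 1 / 2 := by
    rw [hs]; apply one_div_le_one_div_of_le <;> linarith
  have hexp := abs_le.1 (Real.abs_exp_sub_one_sub_id_le (x := -s) (by rw [abs_neg, abs_of_pos hs0]; linarith))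
  have hz1 : Real.exp (-s) ≤ 1 := by rw [Real.exp_le_one_iff]; linarith
  have hNX : (N:ℝ) ≤ X := Nat.floor_le (by linarith)
  have hC₀ := C₀_pos
  have hm : ∑ k ∈ Ioc 0 N, Real.exp (-s) ^ om k * Real.log k ≤
      C₀ * X * Real.exp ((1 - s + s ^ 2) * u ^ 4 + (C + 2)) := by
    refine (moment_low_log N _ (Real.exp_pos _) hz1).trans ?_
    have h2 := sum_low N _ (Real.exp_pos (-s))
    have : Real.exp (-s) * (P N + 2) ≤ (1 - s + s ^ 2) * u ^ 4 + (C + 2) := by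
      calc _ ≤ Real.exp (-s) * (u ^ 4 + (C + 2)) := by
              apply mul_le_mul_of_nonneg_left _ (Real.exp_pos _).le
              linarith
        _ ≤ (1 - s + s ^ 2) * u ^ 4 + 1 * (C + 2) := by
              rw [mul_add]
              gcongr
              linarith [neg_sq s]
        _ = _ := by ring
    have h3 := h2.trans (Real.exp_le_exp.2 this)
    gcongr
  have h1 : ∑ k ∈ Ioc 0 N with (om k : ℝ) ≤ u ^ 4 - u ^ 3 ∧ √X < k,
        Real.exp (-s * (u ^ 4 - u ^ 3)) * (Real.exp (u ^ 4) / 2) ≤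
      ∑ k ∈ Ioc 0 N, Real.exp (-s) ^ om k * Real.log k := by
    refine le_trans ?_ (sum_le_sum_of_subset_of_nonneg
      (filter_subset (fun k => (om k : ℝ) ≤ u ^ 4 - u ^ 3 ∧ √X < k) _)
      (fun i hi _ => mul_nonneg (by positivity) (Real.log_natCast_nonneg _)))
    apply sum_le_sum
    intro k hk
    obtain ⟨h1, h2⟩ := (mem_filter.1 hk).2
    rw [← Real.exp_nat_mul, ← hlogX, ← Real.log_sqrt (by linarith)]
    have hsq : 0 < √X := Real.sqrt_pos.2 (by linarith)
    have : Real.log √X ≤ Real.log k := Real.log_le_log hsq h2.le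
    have h0 : 0 ≤ Real.log √X := by
      rw [Real.log_sqrt (by linarith), hlogX]; positivity
    have h4 : -s * (u ^ 4 - u ^ 3) ≤ om k * (-s) := by nlinarith
    gcongr
  rw [sum_const, nsmul_eq_mul] at h1
  have h3 := h1.trans hm
  have e : (1 - s + s ^ 2) * u ^ 4 + (C+2) =
      (-s * (u ^ 4 - u ^ 3)) + (u ^ 4 + ((C + 2) + (- u ^ 2 / 4))) := by
    rw [hs]; field_simp; ring
  rw [e, Real.exp_add, Real.exp_add (u ^ 4), Real.exp_add (C + 2)] at h3
  have hpos := mul_pos (Real.exp_pos (-s * (u ^ 4 - u ^ 3))) (half_pos (Real.exp_pos (u ^ 4)))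
  have h5 : (({k ∈ Ioc 0 N | (om k : ℝ) ≤ u ^ 4 - u ^ 3 ∧ √X < k}.card : ℕ) : ℝ) ≤
      2 * C₀ * Real.exp (C + 2) * (X * Real.exp (-u ^ 2 / 4)) := by
    refine le_of_mul_le_mul_right (h3.trans (le_of_eq ?_)) hpos
    ring
  have h6 : {k ∈ Ioc 0 N | (om k : ℝ) ≤ u ^ 4 - u ^ 3} ⊆
      Ioc 0 ⌊√X⌋₊ ∪ {k ∈ Ioc 0 N | (om k : ℝ) ≤ u ^ 4 - u ^ 3 ∧ √X < k} := by
    intro k hk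
    rw [mem_filter] at hk
    rw [mem_union, mem_filter]
    by_cases h : √X < k
    · exact Or.inr ⟨hk.1, hk.2, h⟩
    · left
      rw [mem_Ioc] at hk ⊢
      exact ⟨hk.1.1, Nat.le_floor (not_lt.1 h)⟩
  have h7 := (card_le_card h6).trans (card_union_le _ _)
  have h8 : ((Ioc 0 ⌊√X⌋₊).card : ℝ) ≤ √X := by
    simp; exact Nat.floor_le (by positivity)
  have h9 : (({k ∈ Ioc 0 N | (om k : ℝ) ≤ u ^ 4 - u ^ 3}.card : ℕ) : ℝ) ≤ ((Ioc 0 ⌊√X⌋₊).card : ℝ)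
     + (({k ∈ Ioc 0 N | (om k : ℝ) ≤ u ^ 4 - u ^ 3 ∧ √X < k}.card : ℕ) : ℝ) := by exact_mod_cast h7
  linarith


lemma collision {k k' : ℕ} (hk : 0 < k) (hk' : 0 < k') (ha : 0 < om k) (hb : 0 < om k')
    (hne : om k ≠ om k') (h : k * om k = k' * om k') :
    ∃ d, 0 < d ∧ d ∣ om k' ∧ (om k' / d) ∣ k ∧ d ≤ Nat.log 2 (max (om k) (om k')) := by
  obtain ⟨a', b', hco, ea, eb⟩ := Nat.exists_coprime (om k) (om k')
  set d := Nat.gcd (om k) (om k') with hd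
  have hd0 : 0 < d := Nat.gcd_pos_of_pos_left _ ha
  have ha' : a' ≠ 0 := by rintro rfl; simp at ea; omega
  have hb' : b' ≠ 0 := by rintro rfl; simp at eb; omega
  have h1 : k * a' = k' * b' := by
    rw [ea, eb] at h
    apply Nat.eq_of_mul_eq_mul_right hd0
    rw [mul_assoc, mul_assoc]; exact h
  have hbk : b' ∣ k := (Nat.Coprime.symm hco).dvd_of_dvd_mul_right (Dvd.intro_left k' h1.symm)
  obtain ⟨t, rfl⟩ := hbk
  have ht : t ≠ 0 := by rintro rfl; simp at hk
  have e2 : k' = a' * t := by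
    apply Nat.eq_of_mul_eq_mul_right (Nat.pos_of_ne_zero hb')
    rw [← h1]; ring
  refine ⟨d, hd0, Nat.gcd_dvd_right _ _, ?_, ?_⟩
  · have : om k' / d = b' := by rw [eb]; exact Nat.mul_div_cancel _ hd0
    rw [this]; exact Nat.dvd_mul_right _ _
  · have i1 := om_mul_le hb' ht
    have i2 := om_mul_le ha' ht
    have i3 : om t ≤ om (b' * t) := by rw [mul_comm]; exact om_le_mul ht hb'
    have i4 : om t ≤ om (a' * t) := by rw [mul_comm]; exact om_le_mul ht ha'
    rw [← e2] at i2 i4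
    have j1 : a' ≤ om (b' * t) := by
      conv_rhs => rw [ea]
      exact Nat.le_mul_of_pos_right _ hd0
    have j2 : b' ≤ om k' := by
      conv_rhs => rw [eb]
      exact Nat.le_mul_of_pos_right _ hd0
    have l1 : om a' ≤ Nat.log 2 (max (om (b' * t)) (om k')) :=
      Nat.le_log_of_pow_le (by norm_num) ((two_pow_om ha').trans (j1.trans (le_max_left _ _)))
    have l2 : om b' ≤ Nat.log 2 (max (om (b' * t)) (om k')) :=
      Nat.le_log_of_pow_le (by norm_num) ((two_pow_om hb').trans (j2.trans (le_max_right _ _)))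
    have d1 : d ∣ om (b' * t) := Nat.gcd_dvd_left _ _
    have d2 : d ∣ om k' := Nat.gcd_dvd_right _ _
    rcases Nat.lt_or_gt_of_ne hne with hlt | hlt
    · have := Nat.le_of_dvd (by omega) (Nat.dvd_sub d2 d1)
      omega
    · have := Nat.le_of_dvd (by omega) (Nat.dvd_sub d1 d2)
      omega

/-- the set in the statement -/
def S (X : ℝ) : Set ℕ := {n : ℕ | 0 < n ∧ (n : ℝ) ≤ X ∧
          ∃ k : ℕ, 0 < k ∧ n = k * k.primeFactors.card}

lemma S_finite {X : ℝ} (hX : 0 ≤ X) : (S X).Finite := by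
  apply (finite_toSet (Ioc 0 ⌊X⌋₊)).subset
  rintro n ⟨h1, h2, -⟩
  simp only [coe_Ioc, Set.mem_Ioc]
  exact ⟨h1, Nat.le_floor h2⟩

lemma upper {X A : ℝ} (hX : 0 ≤ X) (hA : 0 < A) :
    ((S X).ncard : ℝ) ≤ X / A + ({k ∈ Ioc 0 ⌊X⌋₊ | (om k : ℝ) ≤ A}.card : ℕ) := by
  have h1 : S X ⊆ (((Ioc 0 ⌊X / A⌋₊ ∪ {k ∈ Ioc 0 ⌊X⌋₊ | (om k : ℝ) ≤ A}).image
      (fun k => k * om k) : Finset ℕ) : Set ℕ) := by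
    rintro n ⟨h1, h2, k, hk, rfl⟩
    simp only [coe_image, Set.mem_image, mem_coe, mem_union, mem_filter, mem_Ioc]
    refine ⟨k, ?_, rfl⟩
    change (((k * om k : ℕ) : ℕ) : ℝ) ≤ X at h2
    change 0 < k * om k at h1
    have hom : 0 < om k := Nat.pos_of_mul_pos_left h1
    push_cast at h2
    have hom' : (1:ℝ) ≤ om k := by exact_mod_cast hom
    have hk' : (0:ℝ) < k := by exact_mod_cast hk
    by_cases h : (om k : ℝ) ≤ A
    · right
      exact ⟨⟨hk, Nat.le_floor (by nlinarith)⟩, h⟩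
    · left
      refine ⟨hk, Nat.le_floor ?_⟩
      rw [le_div_iff₀ hA]
      push Not at h
      nlinarith
  have h2 := Set.ncard_le_ncard h1 (finite_toSet _)
  rw [Set.ncard_coe_finset] at h2
  have h3 := h2.trans (card_image_le.trans (card_union_le _ _))
  have h4 : ((Ioc 0 ⌊X / A⌋₊).card : ℝ) ≤ X / A := by
    simp; exact Nat.floor_le (by positivity)
  have h5 : ((S X).ncard : ℝ) ≤ ((Ioc 0 ⌊X / A⌋₊).card : ℝ) +
    ({k ∈ Ioc 0 ⌊X⌋₊ | (om k : ℝ) ≤ A}.card : ℕ) := by exact_mod_cast h3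
  linarith

lemma lower {X A B : ℝ} (hX : 0 ≤ X) (hA : 0 < A) (hB : 1 ≤ B) (hAB : A ≤ B) :
    X / B - 1 - ({k ∈ Ioc 0 ⌊X⌋₊ | (om k : ℝ) ≤ A}.card : ℕ)
      - ({k ∈ Ioc 0 ⌊X⌋₊ | B ≤ (om k : ℝ)}.card : ℕ)
      - (B - A + 1) * (Nat.log 2 ⌊B⌋₊ : ℝ) ^ 2 * (X / B / A) ≤ ((S X).ncard : ℝ) := by
  set M := ⌊X / B⌋₊ with hM
  set D := Nat.log 2 ⌊B⌋₊ with hD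
  set lo : Finset ℕ := {k ∈ Ioc 0 ⌊X⌋₊ | (om k : ℝ) ≤ A}
  set hi : Finset ℕ := {k ∈ Ioc 0 ⌊X⌋₊ | B ≤ (om k : ℝ)}
  set co : Finset ℕ := (Ioc ⌊A⌋₊ ⌊B⌋₊ ×ˢ Ioc 0 D).biUnion
    (fun x => {k ∈ Ioc 0 M | x.2 ∣ x.1 ∧ (x.1 / x.2) ∣ k})
  set G : Finset ℕ := Ioc 0 M \ (lo ∪ hi ∪ co) with hG
  have hXB : X / B ≤ X := div_le_self hX hB
  have hMX : M ≤ ⌊X⌋₊ := Nat.floor_mono hXB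
  have hMr : (M:ℝ) ≤ X / B := Nat.floor_le (by positivity)
  have hGp : ∀ k ∈ G, 0 < k ∧ (k:ℝ) ≤ X / B ∧ A < om k ∧ (om k : ℝ) < B ∧ k ∉ co := by
    intro k hk
    simp only [hG, Finset.mem_sdiff, Finset.mem_union, not_or] at hk
    obtain ⟨h1, ⟨h2, h3⟩, h4⟩ := hk
    rw [mem_Ioc] at h1
    have h5 : k ∈ Ioc 0 ⌊X⌋₊ := mem_Ioc.2 ⟨h1.1, h1.2.trans hMX⟩
    refine ⟨h1.1, le_trans (by exact_mod_cast h1.2) hMr, ?_, ?_, h4⟩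
    · by_contra h
      exact h2 (mem_filter.2 ⟨h5, not_lt.1 h⟩)
    · by_contra h
      exact h3 (mem_filter.2 ⟨h5, not_lt.1 h⟩)
  have hinj : Set.InjOn (fun k => k * om k) (G : Set ℕ) := by
    intro k hk k' hk' h
    simp only at h
    by_contra hne
    obtain ⟨a1, a2, a3, a4, a5⟩ := hGp k hk
    obtain ⟨b1, b2, b3, b4, b5⟩ := hGp k' hk'
    have ok : 0 < om k := by exact_mod_cast hA.trans a3
    have ok' : 0 < om k' := by exact_mod_cast hA.trans b3
    have hone : om k ≠ om k' := by
      intro e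
      rw [e] at h
      exact hne (Nat.eq_of_mul_eq_mul_right ok' h)
    obtain ⟨d, d1, d2, d3, d4⟩ := collision a1 b1 ok ok' hone h
    apply a5
    rw [mem_biUnion]
    refine ⟨(om k', d), ?_, ?_⟩
    · simp only [mem_product, mem_Ioc]
      refine ⟨⟨(Nat.floor_lt hA.le).2 b3, Nat.le_floor b4.le⟩, d1, d4.trans ?_⟩
      apply Nat.log_mono_right
      exact max_le (Nat.le_floor a4.le) (Nat.le_floor b4.le)
    · simp only [mem_filter, mem_Ioc]
      exact ⟨⟨a1, Nat.le_floor a2⟩, d2, d3⟩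
  have hsub : ((G.image (fun k => k * om k) : Finset ℕ) : Set ℕ) ⊆ S X := by
    intro n hn
    simp only [coe_image, Set.mem_image, mem_coe] at hn
    obtain ⟨k, hk, rfl⟩ := hn
    obtain ⟨a1, a2, a3, a4, a5⟩ := hGp k hk
    have ok : 0 < om k := by exact_mod_cast hA.trans a3
    refine ⟨Nat.mul_pos a1 ok, ?_, k, a1, rfl⟩
    push_cast
    calc (k:ℝ) * om k ≤ X / B * B := by gcongr
      _ = X := by field_simp
  have h1 := Set.ncard_le_ncard hsub (S_finite hX)
  rw [Set.ncard_coe_finset, card_image_of_injOn hinj] at h1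
  have h2 : M - (lo ∪ hi ∪ co).card ≤ G.card := by
    have := le_card_sdiff (lo ∪ hi ∪ co) (Ioc 0 M)
    rwa [Nat.card_Ioc, Nat.sub_zero] at this
  have h3 : (lo ∪ hi ∪ co).card ≤ lo.card + hi.card + co.card :=
    (card_union_le _ _).trans (Nat.add_le_add_right (card_union_le _ _) _)
  have h4 : (M:ℝ) ≤ (S X).ncard + lo.card + hi.card + co.card := by
    exact_mod_cast (show M ≤ (S X).ncard + lo.card + hi.card + co.card by omega)
  have h5 : X / B < M + 1 := Nat.lt_floor_add_one _
  have h6 : (co.card : ℝ) ≤ (B - A + 1) * (D : ℝ) ^ 2 * (X / B / A) := by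
    have c1 : (co.card : ℝ) ≤ ∑ x ∈ Ioc ⌊A⌋₊ ⌊B⌋₊ ×ˢ Ioc 0 D,
        (({k ∈ Ioc 0 M | x.2 ∣ x.1 ∧ (x.1 / x.2) ∣ k}.card : ℕ) : ℝ) := by
      exact_mod_cast card_biUnion_le
    have c2 : ∀ x ∈ Ioc ⌊A⌋₊ ⌊B⌋₊ ×ˢ Ioc 0 D,
        (({k ∈ Ioc 0 M | x.2 ∣ x.1 ∧ (x.1 / x.2) ∣ k}.card : ℕ) : ℝ) ≤ D * (X / B / A) := by
      rintro ⟨b, d⟩ hx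
      simp only [mem_product, mem_Ioc] at hx
      obtain ⟨⟨x1, x2⟩, x3, x4⟩ := hx
      have hbA : A < b := (Nat.floor_lt hA.le).1 x1
      by_cases hd : d ∣ b
      · simp only [hd, true_and]
        rw [Nat.Ioc_filter_dvd_card_eq_div]
        have hd0 : (d:ℝ) ≠ 0 := by exact_mod_cast x3.ne'
        calc ((M / (b / d) : ℕ) : ℝ) ≤ M / ((b / d : ℕ) : ℝ) := Nat.cast_div_le
          _ = M / ((b:ℝ) / d) := by rw [Nat.cast_div hd hd0]
          _ = d * (M / b) := by field_simp
          _ ≤ D * (X / B / A) := by gcongr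
      · simp only [hd, false_and, filter_false, card_empty]
        push_cast; positivity
    refine (c1.trans (sum_le_sum c2)).trans ?_
    rw [sum_const, card_product, nsmul_eq_mul]
    simp only [Nat.card_Ioc]
    have f1 : ((⌊B⌋₊ - ⌊A⌋₊ : ℕ) : ℝ) ≤ B - A + 1 := by
      rw [Nat.cast_sub (Nat.floor_mono hAB)]
      linarith [Nat.lt_floor_add_one A, Nat.floor_le (hA.le.trans hAB)]
    push_cast
    calc _ ≤ (B - A + 1) * (D - 0 : ℕ) * (D * (X / B / A)) := by gcongr
      _ = _ := by simp; ring
  linarith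


lemma sqrt_bound {X u : ℝ} (hX : 3 ≤ X) (hu : 2 ≤ u) (hL : Real.log (Real.log X) = u ^ 4) :
    √X ≤ X * Real.exp (-u ^ 2 / 4) := by
  have hlogX : Real.log X = Real.exp (u ^ 4) := by
    rw [← hL, Real.exp_log (Real.log_pos (by linarith))]
  have h1 : Real.exp (u ^ 2 / 4) ≤ √X := by
    rw [← Real.exp_log (show 0 < √X from Real.sqrt_pos.2 (by linarith)),
      Real.log_sqrt (by linarith), hlogX]
    apply Real.exp_le_exp.2
    have := Real.add_one_le_exp (u ^ 4)
    nlinarith [sq_nonneg (u ^ 2 - 1)]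
  have h2 : √X * √X = X := Real.mul_self_sqrt (by linarith)
  have h3 : Real.exp (u ^ 2 / 4) * Real.exp (-u ^ 2 / 4) = 1 := by
    rw [← Real.exp_add, ← Real.exp_zero]; congr 1; ring
  calc √X = √X * (Real.exp (u ^ 2 / 4) * Real.exp (-u ^ 2 / 4)) := by rw [h3, mul_one]
    _ ≤ √X * (√X * Real.exp (-u ^ 2 / 4)) := by gcongr
    _ = _ := by rw [← mul_assoc, h2]

lemma log_bound {u : ℝ} (hu : 2 ≤ u) : (Nat.log 2 ⌊u ^ 4 + u ^ 3⌋₊ : ℝ) ≤ 10 * Real.log u := by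
  have hB : (1:ℝ) ≤ u ^ 4 + u ^ 3 := by
    have := one_le_pow₀ (show 1 ≤ u by linarith) (n := 4)
    have : 0 ≤ u ^ 3 := by positivity
    linarith
  have hB0 : ⌊u ^ 4 + u ^ 3⌋₊ ≠ 0 := by
    have : 1 ≤ ⌊u ^ 4 + u ^ 3⌋₊ := Nat.le_floor (by exact_mod_cast hB)
    omega
  have h1 := Nat.pow_log_le_self 2 hB0
  set D := Nat.log 2 ⌊u ^ 4 + u ^ 3⌋₊
  have h2 : (2:ℝ) ^ D ≤ u ^ 5 := by
    have e : (2:ℝ) ^ D ≤ (⌊u ^ 4 + u ^ 3⌋₊ : ℝ) := by exact_mod_cast h1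
    refine e.trans ((Nat.floor_le (by linarith)).trans ?_)
    have : 0 ≤ u ^ 3 := by positivity
    nlinarith [mul_nonneg this (show 0 ≤ u ^ 2 - u - 1 by nlinarith)]
  have h3 := Real.log_le_log (by positivity) h2
  rw [Real.log_pow, Real.log_pow] at h3
  have h4 : (1:ℝ)/2 ≤ Real.log 2 := by linarith [Real.log_two_gt_d9]
  have : (D:ℝ) * (1/2) ≤ D * Real.log 2 := by gcongr
  push_cast at h3
  linarith

lemma bounds : ∃ K : ℝ, ∀ X u : ℝ, 3 ≤ X → 2 ≤ u → Real.log (Real.log X) = u ^ 4 →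
    ((S X).ncard : ℝ) / (X / u ^ 4) ≤ 1 / (1 - 1 / u) + K * (u ^ 4 * Real.exp (-u ^ 2 / 4)) ∧
    1 / (1 + 1 / u) - K * (u ^ 4 * Real.exp (-u ^ 2 / 4)) - 600 * (Real.log u ^ 2 / u) ≤
      ((S X).ncard : ℝ) / (X / u ^ 4) := by
  obtain ⟨K₁, hK₁, H₁⟩ := tail_up
  obtain ⟨K₂, hK₂, H₂⟩ := tail_low
  refine ⟨K₁ + K₂ + 2, fun X u hX hu hL => ?_⟩
  have t1 := H₁ X u hX (by linarith) hL
  have t2 := H₂ X u hX (by linarith) hL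
  have t3 := sqrt_bound hX hu hL
  have t4 := log_bound hu
  have u3 : 0 < u ^ 3 := by positivity
  have hu0 : 0 < u := by linarith
  have hu1 : 0 < u - 1 := by linarith
  have hA : 0 < u ^ 4 - u ^ 3 := by nlinarith [mul_pos u3 hu1]
  have hB : 1 ≤ u ^ 4 + u ^ 3 := by
    have := one_le_pow₀ (show 1 ≤ u by linarith) (n := 4)
    linarith
  have hX0 : 0 < X := by linarith
  have h1 := upper hX0.le hA
  have h2 := lower hX0.le hA hB (by linarith)
  have hone : 1 ≤ √X := by rw [Real.one_le_sqrt]; linarith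
  set E := X * Real.exp (-u ^ 2 / 4) with hE
  have hE0 : 0 ≤ E := by positivity
  have eE : (K₁ + K₂ + 2) * (u ^ 4 * Real.exp (-u ^ 2 / 4)) * (X / u ^ 4) = (K₁ + K₂ + 2) * E := by
    rw [hE]; field_simp
  have hq : 0 < X / u ^ 4 := by positivity
  constructor
  · rw [div_le_iff₀ hq, add_mul, eE]
    have e : 1 / (1 - 1/u) * (X / u ^ 4) = X / (u ^ 4 - u ^ 3) := by
      have e1 : 1 - 1/u = (u - 1)/u := by field_simp
      have e2 : u ^ 4 - u ^ 3 = u ^ 3 * (u - 1) := by ring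
      rw [e1, e2]; field_simp
    rw [e]
    nlinarith [mul_nonneg hK₁ hE0]
  · rw [le_div_iff₀ hq, sub_mul, sub_mul, eE]
    have e : 1 / (1 + 1/u) * (X / u ^ 4) = X / (u ^ 4 + u ^ 3) := by
      have e1 : 1 + 1/u = (u + 1)/u := by field_simp
      have e2 : u ^ 4 + u ^ 3 = u ^ 3 * (u + 1) := by ring
      rw [e1, e2]; field_simp
    rw [e]
    have hc : (u ^ 4 + u ^ 3 - (u ^ 4 - u ^ 3) + 1) * (Nat.log 2 ⌊u ^ 4 + u ^ 3⌋₊ : ℝ) ^ 2 *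
        (X / (u ^ 4 + u ^ 3) / (u ^ 4 - u ^ 3)) ≤ 600 * (Real.log u ^ 2 / u) * (X / u ^ 4) := by
      have c1 : u ^ 4 + u ^ 3 - (u ^ 4 - u ^ 3) + 1 ≤ 3 * u ^ 3 := by
        have := one_le_pow₀ (show 1 ≤ u by linarith) (n := 3)
        linarith
      have c2 : u ^ 4 ≤ u ^ 4 + u ^ 3 := by linarith
      have c3 : u ^ 4 / 2 ≤ u ^ 4 - u ^ 3 := by nlinarith
      have c0 : 0 ≤ u ^ 4 + u ^ 3 - (u ^ 4 - u ^ 3) + 1 := by linarith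
      calc _ ≤ (3 * u ^ 3) * (10 * Real.log u) ^ 2 * (X / u ^ 4 / (u ^ 4 / 2)) := by gcongr
        _ = _ := by field_simp; ring
    linarith

lemma tendsto_main : Tendsto (fun X : ℝ => ((S X).ncard : ℝ) / (X / Real.log (Real.log X)))
    atTop (𝓝 1) := by
  obtain ⟨K, hK⟩ := bounds
  set U : ℝ → ℝ := fun X => (Real.log (Real.log X)) ^ ((1:ℝ)/4) with hU
  have hLL : Tendsto (fun X => Real.log (Real.log X)) atTop atTop :=
    Real.tendsto_log_atTop.comp Real.tendsto_log_atTop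
  have hUt : Tendsto U atTop atTop := (tendsto_rpow_atTop (by norm_num)).comp hLL
  have l1 : Tendsto (fun u : ℝ => 1 / u) atTop (𝓝 0) := by
    simpa using tendsto_inv_atTop_zero (𝕜 := ℝ)
  have l2 : Tendsto (fun u : ℝ => u ^ 4 * Real.exp (-u ^ 2 / 4)) atTop (𝓝 0) := by
    have h := (Real.tendsto_pow_mul_exp_neg_atTop_nhds_zero 2).comp
      ((tendsto_pow_atTop (α := ℝ) (n := 2) (by norm_num)).atTop_div_const (show (0:ℝ) < 4 by norm_num))
    have h' := h.const_mul 16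
    rw [mul_zero] at h'
    refine h'.congr fun u => ?_
    simp only [Function.comp]
    rw [neg_div]; ring
  have l3 : Tendsto (fun u : ℝ => Real.log u ^ 2 / u) atTop (𝓝 0) :=
    (Real.isLittleO_pow_log_id_atTop (n := 2)).tendsto_div_nhds_zero
  have up : Tendsto (fun u : ℝ => 1 / (1 - 1 / u) + K * (u ^ 4 * Real.exp (-u ^ 2 / 4))) atTop (𝓝 1) := by
    have := ((l1.const_sub 1).inv₀ (by norm_num)).add (l2.const_mul K)
    simpa using this
  have lo : Tendsto (fun u : ℝ => 1 / (1 + 1 / u) - K * (u ^ 4 * Real.exp (-u ^ 2 / 4))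
      - 600 * (Real.log u ^ 2 / u)) atTop (𝓝 1) := by
    have := (((l1.const_add 1).inv₀ (by norm_num)).sub (l2.const_mul K)).sub (l3.const_mul 600)
    simpa using this
  have hev : ∀ᶠ X : ℝ in atTop, 3 ≤ X ∧ 2 ≤ U X ∧ Real.log (Real.log X) = U X ^ 4 := by
    filter_upwards [eventually_ge_atTop 3, hUt.eventually_ge_atTop 2, hLL.eventually_ge_atTop 0] with X a b c
    refine ⟨a, b, ?_⟩
    simp only [hU]
    rw [← Real.rpow_natCast, ← Real.rpow_mul c]
    norm_num
  refine tendsto_of_tendsto_of_tendsto_of_le_of_le' (lo.comp hUt) (up.comp hUt) ?_ ?_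
  · filter_upwards [hev] with X hX
    have := (hK X (U X) hX.1 hX.2.1 hX.2.2).2
    rw [hX.2.2]
    exact this
  · filter_upwards [hev] with X hX
    have := (hK X (U X) hX.1 hX.2.1 hX.2.2).1
    rw [hX.2.2]
    exact this

end OmegaX

/-- With ω_X := #{n ≤ X : n = k·ω(k) for some positive integer k}, where
ω(k) is the number of distinct prime divisors of k, one has
ω_X = X/log log X + o(X/log log X) as X → ∞, i.e. ω_X / (X/log log X) → 1. -/
theorem stmt_17 :
    Tendsto (fun X : ℝ =>
      (({n : ℕ | 0 < n ∧ (n : ℝ) ≤ X ∧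
          ∃ k : ℕ, 0 < k ∧ n = k * k.primeFactors.card}.ncard : ℝ))
        / (X / Real.log (Real.log X))) atTop (𝓝 1) := by
  exact OmegaX.tendsto_main
end

section
/- Let φ denote Euler's totient function and, for a real number X > 0, let φ_X := #{n ≤ X : n = k·φ(k) for some k ∈ ℕ}. Then φ_X = c·X^{1/2} + o(X^{1/2}) as X → ∞, where c = ∏_p (1 + 1/(p(p − 1 + √(p² − p)))), the product being over all primes p. -/
open Filter Topology

lemma aux_val (k q : ℕ) (hk : 0 < k) (hq : q.Prime) :
    (k * Nat.totient k).factorization q + (if q ∣ k then 1 else 0) =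
      2 * k.factorization q +
        ∑ p ∈ k.primeFactors with q < p, (p - 1).factorization q := by
  have hφ : 0 < Nat.totient k := Nat.totient_pos.2 hk
  have hpp : ∀ p ∈ k.primeFactors, p.Prime := fun p hp => Nat.prime_of_mem_primeFactors hp
  have hP : ∏ p ∈ k.primeFactors, p ≠ 0 :=
    Finset.prod_ne_zero_iff.2 fun p hp => (hpp p hp).ne_zero
  have hne : ∀ p ∈ k.primeFactors, p - 1 ≠ 0 := fun p hp => by
    have := (hpp p hp).two_le; omega
  have hP1 : ∏ p ∈ k.primeFactors, (p - 1) ≠ 0 := Finset.prod_ne_zero_iff.2 hne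
  have h := Nat.totient_mul_prod_primeFactors k
  have h2 : (k * Nat.totient k) * ∏ p ∈ k.primeFactors, p
      = k * k * ∏ p ∈ k.primeFactors, (p - 1) := by
    rw [mul_assoc, h, mul_assoc]
  have h3 := congrArg (fun n => n.factorization q) h2
  rw [Nat.factorization_mul (by positivity) hP, Nat.factorization_mul (by positivity) hP1,
    Nat.factorization_mul hk.ne' hk.ne', Nat.factorization_prod hne,
    Nat.factorization_prod (fun p hp => (hpp p hp).ne_zero)] at h3
  simp only [Finsupp.add_apply, Finsupp.finsetSum_apply] at h3
  have e1 : ∑ p ∈ k.primeFactors, p.factorization q = if q ∣ k then 1 else 0 := by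
    rw [Finset.sum_congr rfl (fun p hp => by
      rw [(hpp p hp).factorization, Finsupp.single_apply])]
    rw [Finset.sum_ite_eq']
    simp [Nat.mem_primeFactors, hq, hk.ne']
  have e2 : ∑ p ∈ k.primeFactors with q < p, (p - 1).factorization q
      = ∑ p ∈ k.primeFactors, (p - 1).factorization q := by
    apply Finset.sum_filter_of_ne
    intro p hp h
    by_contra hlt
    apply h
    apply Nat.factorization_eq_zero_of_lt
    have := (hpp p hp).two_le
    omega
  rw [e1] at h3
  rw [e2, h3]
  ring

lemma aux_inj (k m : ℕ) (hk : 0 < k) (hm : 0 < m)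
    (h : k * Nat.totient k = m * Nat.totient m) : k = m := by
  by_contra hne
  set D := (k.primeFactors ∪ m.primeFactors).filter
    (fun q => k.factorization q ≠ m.factorization q) with hD
  have hDmem : ∀ q, k.factorization q ≠ m.factorization q → q ∈ D := by
    intro q hq
    rw [hD, Finset.mem_filter, Finset.mem_union]
    refine ⟨?_, hq⟩
    by_contra hc
    push Not at hc
    apply hq
    rw [← Nat.support_factorization, ← Nat.support_factorization, Finsupp.notMem_support_iff,
      Finsupp.notMem_support_iff] at hc
    rw [hc.1, hc.2]
  have hDne : D.Nonempty := by
    by_contra hc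
    apply hne
    apply Nat.eq_of_factorization_eq hk.ne' hm.ne'
    intro q
    by_contra hq
    exact hc ⟨q, hDmem q hq⟩
  obtain ⟨q, hqD, hmax⟩ := Finset.exists_max_image D id hDne
  have hq : q.Prime := by
    rw [hD, Finset.mem_filter, Finset.mem_union] at hqD
    rcases hqD.1 with h | h <;> exact Nat.prime_of_mem_primeFactors h
  have hqne : k.factorization q ≠ m.factorization q := (Finset.mem_filter.1 hqD).2
  have heq : ∀ p, q < p → k.factorization p = m.factorization p := by
    intro p hp
    by_contra hc
    exact absurd (hmax p (hDmem p hc)) (by simpa using hp)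
  have hsets : k.primeFactors.filter (fun p => q < p) = m.primeFactors.filter (fun p => q < p) := by
    ext p
    simp only [Finset.mem_filter, ← Nat.support_factorization, Finsupp.mem_support_iff]
    constructor
    · rintro ⟨a, b⟩; exact ⟨by rwa [← heq p b], b⟩
    · rintro ⟨a, b⟩; exact ⟨by rwa [heq p b], b⟩
  have h1 := aux_val k q hk hq
  have h2 := aux_val m q hm hq
  rw [hsets, h] at h1
  have d1 : q ∣ k ↔ k.factorization q ≠ 0 := by
    rw [← Nat.one_le_iff_ne_zero, ← hq.dvd_iff_one_le_factorization hk.ne']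
  have d2 : q ∣ m ↔ m.factorization q ≠ 0 := by
    rw [← Nat.one_le_iff_ne_zero, ← hq.dvd_iff_one_le_factorization hm.ne']
  simp only [d1, d2] at h1 h2
  split_ifs at h1 h2 <;> omega

/-- the function p/(p-1) -/
noncomputable def rr (p : ℕ) : ℝ := 1 + 1 / ((p : ℝ) - 1)

lemma rr_ge (p : ℕ) (hp : p.Prime) : 1 ≤ rr p := by
  have : (2 : ℝ) ≤ p := by exact_mod_cast hp.two_le
  unfold rr
  have : 0 ≤ 1 / ((p : ℝ) - 1) := by apply div_nonneg <;> linarith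
  linarith

lemma div_totient (k : ℕ) (hk : 0 < k) :
    (k : ℝ) / Nat.totient k = ∏ p ∈ k.primeFactors, rr p := by
  have h := Nat.totient_mul_prod_primeFactors k
  have hφ : (0 : ℝ) < Nat.totient k := by exact_mod_cast Nat.totient_pos.2 hk
  have hpp : ∀ p ∈ k.primeFactors, (2 : ℝ) ≤ p := fun p hp => by
    exact_mod_cast (Nat.prime_of_mem_primeFactors hp).two_le
  have h2 : (Nat.totient k : ℝ) * ∏ p ∈ k.primeFactors, (p : ℝ)
      = k * ∏ p ∈ k.primeFactors, ((p : ℝ) - 1) := by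
    have := congrArg (Nat.cast : ℕ → ℝ) h
    push_cast at this
    rw [this]
    congr 1
    apply Finset.prod_congr rfl
    intro p hp
    rw [Nat.cast_sub (Nat.prime_of_mem_primeFactors hp).one_le]; simp
  have h3 : ∏ p ∈ k.primeFactors, rr p
      = (∏ p ∈ k.primeFactors, (p : ℝ)) / ∏ p ∈ k.primeFactors, ((p : ℝ) - 1) := by
    rw [← Finset.prod_div_distrib]
    apply Finset.prod_congr rfl
    intro p hp
    have := hpp p hp
    unfold rr
    have : (p : ℝ) - 1 ≠ 0 := by linarith
    field_simp
    ring
  have h4 : ∏ p ∈ k.primeFactors, ((p : ℝ) - 1) ≠ 0 := by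
    apply Finset.prod_ne_zero_iff.2
    intro p hp
    have := hpp p hp
    linarith
  rw [h3, div_eq_div_iff hφ.ne' h4]
  linarith

lemma prod_rr_le (k : ℕ) (hk : 0 < k) (s : Finset ℕ) (hs : s ⊆ k.primeFactors) :
    ∏ p ∈ s, rr p ≤ ∑ d ∈ k.divisors with d.primeFactors ⊆ s, 1 / (Nat.totient d : ℝ) := by
  have hsp : ∀ p ∈ s, p.Prime := fun p hp => Nat.prime_of_mem_primeFactors (hs hp)
  unfold rr
  rw [Finset.prod_one_add]
  have hpf : ∀ t ∈ s.powerset, (∏ p ∈ t, p).primeFactors = t := by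
    intro t ht
    exact Nat.primeFactors_prod fun p hp => hsp p (Finset.mem_powerset.1 ht hp)
  have hinj : Set.InjOn (fun t : Finset ℕ => ∏ p ∈ t, p) (s.powerset : Set (Finset ℕ)) := by
    intro t ht u hu h
    rw [← hpf t ht, ← hpf u hu]
    exact congrArg _ h
  have e : ∀ t ∈ s.powerset, ∏ p ∈ t, 1 / ((p : ℝ) - 1)
      = 1 / (Nat.totient (∏ p ∈ t, p) : ℝ) := by
    intro t ht
    have htp : ∀ p ∈ t, p.Prime := fun p hp => hsp p (Finset.mem_powerset.1 ht hp)
    have h := Nat.totient_mul_prod_primeFactors (∏ p ∈ t, p)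
    rw [hpf t ht, mul_comm] at h
    have h0 : 0 < ∏ p ∈ t, p := Finset.prod_pos fun p hp => (htp p hp).pos
    rw [Nat.eq_of_mul_eq_mul_left h0 h, Nat.cast_prod, one_div, ← Finset.prod_inv_distrib]
    apply Finset.prod_congr rfl
    intro p hp
    rw [Nat.cast_sub (htp p hp).one_le]; simp
  rw [Finset.sum_congr rfl e, ← Finset.sum_image (f := fun d => 1 / (Nat.totient d : ℝ)) hinj]
  apply Finset.sum_le_sum_of_subset_of_nonneg
  · intro d hd
    obtain ⟨t, ht, rfl⟩ := Finset.mem_image.1 hd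
    simp only [Finset.mem_filter, Nat.mem_divisors]
    refine ⟨⟨?_, hk.ne'⟩, ?_⟩
    · exact (Finset.prod_dvd_prod_of_subset _ _ _
        ((Finset.mem_powerset.1 ht).trans hs)).trans (Nat.prod_primeFactors_dvd k)
    · rw [hpf t ht]; exact Finset.mem_powerset.1 ht
  · intros; positivity

lemma card_div_le (n : ℕ) (hn : 0 < n) : ((n.divisors.card : ℕ) : ℝ) ≤ 2 * Real.sqrt n := by
  have h : n.divisors ⊆ Finset.Icc 1 n.sqrt ∪ (Finset.Icc 1 n.sqrt).image (fun d => n / d) := by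
    intro d hd
    have hdn := Nat.dvd_of_mem_divisors hd
    have hd0 := Nat.pos_of_mem_divisors hd
    obtain ⟨e, rfl⟩ := hdn
    have he : 0 < e := Nat.pos_of_mul_pos_left hn
    rw [Finset.mem_union, Finset.mem_image]
    by_cases hle : d ≤ e
    · left; rw [Finset.mem_Icc]; exact ⟨hd0, Nat.le_sqrt.2 (Nat.mul_le_mul_left _ hle)⟩
    · right; refine ⟨e, ?_, Nat.mul_div_cancel _ he⟩
      rw [Finset.mem_Icc]; exact ⟨he, Nat.le_sqrt.2 (Nat.mul_le_mul_right _ (by omega))⟩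
  have h2 : n.divisors.card ≤ n.sqrt + n.sqrt := by
    refine (Finset.card_le_card h).trans ((Finset.card_union_le _ _).trans ?_)
    refine Nat.add_le_add (by simp) (Finset.card_image_le.trans (by simp))
  have h3 : (n.sqrt : ℝ) ≤ Real.sqrt n := Real.nat_sqrt_le_real_sqrt
  have h4 : (n.divisors.card : ℝ) ≤ n.sqrt + n.sqrt := by exact_mod_cast h2
  linarith

lemma F_le (k : ℕ) (hk : 0 < k) :
    (k : ℝ) / Nat.totient k ≤ ∑ d ∈ k.divisors, 1 / (Nat.totient d : ℝ) := by
  rw [div_totient k hk]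
  refine (prod_rr_le k hk _ le_rfl).trans ?_
  apply Finset.sum_le_sum_of_subset_of_nonneg (Finset.filter_subset _ _)
  intros; positivity

noncomputable def WW (d : ℕ) : ℝ := 1 / ((d : ℝ) * Nat.totient d)

lemma WW_nonneg (d : ℕ) : 0 ≤ WW d := by unfold WW; positivity

lemma WW_summable : Summable WW := by
  have hs : Summable (fun n : ℕ => 2 * (1 / (n : ℝ) ^ (3 / 2 : ℝ))) :=
    (Real.summable_one_div_nat_rpow.2 (by norm_num)).mul_left 2
  refine Summable.of_nonneg_of_le WW_nonneg ?_ hs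
  intro n
  rcases Nat.eq_zero_or_pos n with rfl | hn
  · simp [WW]
  have hn' : (0 : ℝ) < n := by exact_mod_cast hn
  have hφ : (0 : ℝ) < Nat.totient n := by exact_mod_cast Nat.totient_pos.2 hn
  have h1 : (n : ℝ) / Nat.totient n ≤ 2 * Real.sqrt n := by
    refine (F_le n hn).trans (le_trans ?_ (card_div_le n hn))
    rw [Finset.card_eq_sum_ones, Nat.cast_sum]
    apply Finset.sum_le_sum
    intro d hd
    have : (1 : ℝ) ≤ Nat.totient d := by
      exact_mod_cast Nat.totient_pos.2 (Nat.pos_of_mem_divisors hd)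
    rw [Nat.cast_one, div_le_one (by linarith)]; exact this
  have h2 : WW n = ((n : ℝ) / Nat.totient n) / n ^ 2 := by
    unfold WW; field_simp
  have h3 : (n : ℝ) ^ 2 = Real.sqrt n * (n : ℝ) ^ (3 / 2 : ℝ) := by
    rw [Real.sqrt_eq_rpow, ← Real.rpow_add hn']; norm_num
  have hs0 : 0 < Real.sqrt n := Real.sqrt_pos.2 hn'
  have hp0 : 0 < (n : ℝ) ^ (3 / 2 : ℝ) := Real.rpow_pos_of_pos hn' _
  rw [h2, h3, div_le_iff₀ (by positivity)]
  refine h1.trans (le_of_eq ?_)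
  field_simp

noncomputable def dl (z : ℕ) : ℝ := (∑' d, WW d) - ∑ d ∈ Finset.range z, WW d

lemma dl_tendsto : Tendsto dl atTop (𝓝 0) := by
  have := (WW_summable.hasSum.tendsto_sum_nat).const_sub (∑' d, WW d)
  rw [sub_self] at this
  exact this

lemma sum_le_dl (z : ℕ) (t : Finset ℕ) (ht : ∀ d ∈ t, z ≤ d) : ∑ d ∈ t, WW d ≤ dl z := by
  have hd : Disjoint t (Finset.range z) := by
    rw [Finset.disjoint_left]; intro d hd h
    have := ht d hd
    rw [Finset.mem_range] at h; omega
  have := WW_summable.sum_le_tsum (t ∪ Finset.range z) (fun d _ => WW_nonneg d)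
  rw [Finset.sum_union hd] at this
  unfold dl; linarith

noncomputable def FS (z k : ℕ) : ℝ := ∏ p ∈ Nat.primesBelow z, if p ∣ k then rr p else 1

noncomputable def RR (z k : ℕ) : ℝ := ∏ p ∈ k.primeFactors with z ≤ p, rr p

lemma RR_ge (z k : ℕ) : 1 ≤ RR z k := by
  unfold RR
  refine Finset.prod_induction _ (fun x : ℝ => 1 ≤ x)
    (fun a b ha hb => one_le_mul_of_one_le_of_one_le ha hb) le_rfl ?_
  intro p hp
  exact rr_ge p (Nat.prime_of_mem_primeFactors (Finset.mem_filter.1 hp).1)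

lemma FS_ge (z k : ℕ) : 1 ≤ FS z k := by
  unfold FS
  refine Finset.prod_induction _ (fun x : ℝ => 1 ≤ x) (fun a b ha hb => one_le_mul_of_one_le_of_one_le ha hb) le_rfl ?_
  intro p hp
  split_ifs
  · exact rr_ge p (Nat.prime_of_mem_primesBelow hp)
  · exact le_rfl

lemma F_eq (z k : ℕ) (hk : 0 < k) : (k : ℝ) / Nat.totient k = FS z k * RR z k := by
  rw [div_totient k hk, FS, RR, ← Finset.prod_filter,
    ← Finset.prod_filter_mul_prod_filter_not k.primeFactors (fun p => p < z)]
  congr 1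
  · apply Finset.prod_congr _ (fun _ _ => rfl)
    ext p
    simp only [Finset.mem_filter, Nat.mem_primeFactors, Nat.mem_primesBelow]
    have := hk.ne'
    tauto
  · simp only [not_lt]

lemma RR_le (z k : ℕ) (hk : 0 < k) :
    RR z k ≤ 1 + ∑ d ∈ k.divisors with z ≤ d, 1 / (Nat.totient d : ℝ) := by
  refine (prod_rr_le k hk _ (Finset.filter_subset _ _)).trans ?_
  have hsub : (k.divisors.filter fun d => d.primeFactors ⊆ k.primeFactors.filter (fun p => z ≤ p))
      ⊆ {1} ∪ k.divisors.filter (fun d => z ≤ d) := by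
    intro d hd
    rw [Finset.mem_filter] at hd
    rw [Finset.mem_union, Finset.mem_singleton, Finset.mem_filter]
    by_cases h1 : d = 1
    · exact Or.inl h1
    · right
      refine ⟨hd.1, ?_⟩
      have hd0 := Nat.pos_of_mem_divisors hd.1
      have hm : d.minFac ∈ d.primeFactors :=
        Nat.mem_primeFactors.2 ⟨Nat.minFac_prime h1, Nat.minFac_dvd d, hd0.ne'⟩
      exact ((Finset.mem_filter.1 (hd.2 hm)).2).trans (Nat.minFac_le hd0)
  refine (Finset.sum_le_sum_of_subset_of_nonneg hsub (fun _ _ _ => by positivity)).trans ?_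
  refine (Finset.sum_union_inter (s₁ := {1}) (s₂ := k.divisors.filter (fun d => z ≤ d))
    (f := fun d => 1 / (Nat.totient d : ℝ)) ▸ le_add_of_nonneg_right
      (Finset.sum_nonneg (fun _ _ => by positivity))).trans ?_
  simp

lemma bad_count (z n : ℕ) (ε : ℝ) :
    (((Finset.Ioc 0 n).filter (fun k => 1 + ε ≤ RR z k)).card : ℝ) * ε ≤ n * dl z := by
  have h1 : (((Finset.Ioc 0 n).filter (fun k => 1 + ε ≤ RR z k)).card : ℝ) * ε
      ≤ ∑ k ∈ (Finset.Ioc 0 n).filter (fun k => 1 + ε ≤ RR z k),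
        ∑ d ∈ k.divisors with z ≤ d, 1 / (Nat.totient d : ℝ) := by
    rw [← nsmul_eq_mul]
    apply Finset.card_nsmul_le_sum
    intro k hk
    rw [Finset.mem_filter, Finset.mem_Ioc] at hk
    have := RR_le z k hk.1.1
    linarith [hk.2]
  refine h1.trans ?_
  have h2 : ∑ k ∈ (Finset.Ioc 0 n).filter (fun k => 1 + ε ≤ RR z k),
        ∑ d ∈ k.divisors with z ≤ d, 1 / (Nat.totient d : ℝ)
      ≤ ∑ k ∈ Finset.Ioc 0 n, ∑ d ∈ k.divisors with z ≤ d, 1 / (Nat.totient d : ℝ) := by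
    apply Finset.sum_le_sum_of_subset_of_nonneg (Finset.filter_subset _ _)
    intros
    exact Finset.sum_nonneg (fun _ _ => by positivity)
  refine h2.trans ?_
  rw [Finset.sum_comm' (t' := (Finset.Ioc 0 n).filter (fun d => z ≤ d))
    (s' := fun d => (Finset.Ioc 0 n).filter (fun k => d ∣ k))]
  · have h3 := sum_le_dl z ((Finset.Ioc 0 n).filter (fun d => z ≤ d))
      (fun d hd => (Finset.mem_filter.1 hd).2)
    refine le_trans ?_ (mul_le_mul_of_nonneg_left h3 (Nat.cast_nonneg n))
    rw [Finset.mul_sum]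
    apply Finset.sum_le_sum
    intro d hd
    have hd0 : 0 < d := (Finset.mem_Ioc.1 (Finset.mem_filter.1 hd).1).1
    have hd0' : (0 : ℝ) < d := by exact_mod_cast hd0
    have hφ : (0 : ℝ) < Nat.totient d := by exact_mod_cast Nat.totient_pos.2 hd0
    rw [Finset.sum_const, Nat.Ioc_filter_dvd_card_eq_div, nsmul_eq_mul]
    have : ((n / d : ℕ) : ℝ) ≤ n / d := Nat.cast_div_le
    refine (mul_le_mul_of_nonneg_right this (by positivity)).trans (le_of_eq ?_)
    unfold WW
    field_simp
  · intro k d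
    simp only [Finset.mem_Ioc, Finset.mem_filter, Nat.mem_divisors]
    constructor
    · rintro ⟨⟨a, b⟩, ⟨c, e⟩, f⟩
      exact ⟨⟨⟨a, b⟩, c⟩, ⟨Nat.pos_of_dvd_of_pos c a, (Nat.le_of_dvd a c).trans b⟩, f⟩
    · rintro ⟨⟨⟨a, b⟩, c⟩, _, f⟩
      exact ⟨⟨a, b⟩, ⟨c, a.ne'⟩, f⟩

lemma inner_tail (T : ℝ) (hT : 0 < T) (n d : ℕ) (hd : 0 < d) :
    ∑ k ∈ (Finset.Ioc ⌊T⌋₊ n).filter (fun k => d ∣ k), 1 / (k : ℝ) ^ 2 ≤ 2 / (d * T) := by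
  have hd' : (0 : ℝ) < d := by exact_mod_cast hd
  have hsub : (Finset.Ioc ⌊T⌋₊ n).filter (fun k => d ∣ k) ⊆
      (Finset.Ioo ⌊T / d⌋₊ (n + 1)).image (fun m => d * m) := by
    intro k hk
    rw [Finset.mem_filter, Finset.mem_Ioc] at hk
    obtain ⟨⟨h1, h2⟩, m, rfl⟩ := hk
    refine Finset.mem_image.2 ⟨m, ?_, rfl⟩
    rw [Finset.mem_Ioo]
    constructor
    · rw [Nat.floor_lt (by positivity)] at h1 ⊢
      rw [div_lt_iff₀ hd']
      push_cast at h1; linarith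
    · have : m ≤ d * m := Nat.le_mul_of_pos_left m hd
      omega
  refine (Finset.sum_le_sum_of_subset_of_nonneg hsub (fun _ _ _ => by positivity)).trans ?_
  rw [Finset.sum_image (fun a _ b _ h => Nat.eq_of_mul_eq_mul_left hd h)]
  have e : ∀ m ∈ Finset.Ioo ⌊T / d⌋₊ (n + 1), 1 / (((d * m : ℕ) : ℝ)) ^ 2
      = (1 / (d : ℝ) ^ 2) * ((m : ℝ) ^ 2)⁻¹ := by
    intro m _
    push_cast
    rw [mul_pow, one_div, mul_inv, one_div]
  rw [Finset.sum_congr rfl e, ← Finset.mul_sum]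
  have h := sum_Ioo_inv_sq_le (α := ℝ) ⌊T / d⌋₊ (n + 1)
  have h2 : 2 / ((⌊T / d⌋₊ : ℝ) + 1) ≤ 2 / (T / d) :=
    div_le_div_of_nonneg_left (by norm_num) (by positivity) (Nat.lt_floor_add_one _).le
  refine (mul_le_mul_of_nonneg_left (h.trans h2) (by positivity)).trans (le_of_eq ?_)
  field_simp

lemma tail_sum (T : ℝ) (hT : 0 < T) (n : ℕ) :
    ∑ k ∈ Finset.Ioc ⌊T⌋₊ n, WW k ≤ 2 * (∑' d, WW d) / T := by
  have h1 : ∑ k ∈ Finset.Ioc ⌊T⌋₊ n, WW k ≤ ∑ k ∈ Finset.Ioc ⌊T⌋₊ n,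
      ∑ d ∈ k.divisors, 1 / (Nat.totient d : ℝ) * (1 / (k : ℝ) ^ 2) := by
    apply Finset.sum_le_sum
    intro k hk
    have hk0 : 0 < k := by rw [Finset.mem_Ioc] at hk; omega
    have hk0' : (0 : ℝ) < k := by exact_mod_cast hk0
    have hφ : (0 : ℝ) < Nat.totient k := by exact_mod_cast Nat.totient_pos.2 hk0
    rw [← Finset.sum_mul]
    have e : WW k = (k : ℝ) / Nat.totient k * (1 / (k : ℝ) ^ 2) := by
      unfold WW; field_simp
    rw [e]
    exact mul_le_mul_of_nonneg_right (F_le k hk0) (by positivity)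
  refine h1.trans ?_
  rw [Finset.sum_comm' (t' := Finset.Ioc 0 n)
    (s' := fun d => (Finset.Ioc ⌊T⌋₊ n).filter (fun k => d ∣ k))]
  · have h3 := WW_summable.sum_le_tsum (Finset.Ioc 0 n) (fun d _ => WW_nonneg d)
    have h4 : 2 * (∑ d ∈ Finset.Ioc 0 n, WW d) / T ≤ 2 * (∑' d, WW d) / T := by gcongr
    refine le_trans ?_ h4
    rw [Finset.mul_sum, Finset.sum_div]
    apply Finset.sum_le_sum
    intro d hd
    have hd0 : 0 < d := (Finset.mem_Ioc.1 hd).1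
    have hd0' : (0 : ℝ) < d := by exact_mod_cast hd0
    have hφ : (0 : ℝ) < Nat.totient d := by exact_mod_cast Nat.totient_pos.2 hd0
    rw [← Finset.mul_sum]
    refine (mul_le_mul_of_nonneg_left (inner_tail T hT n d hd0) (by positivity)).trans
      (le_of_eq ?_)
    unfold WW
    field_simp
  · intro k d
    simp only [Finset.mem_Ioc, Finset.mem_filter, Nat.mem_divisors]
    constructor
    · rintro ⟨⟨a, b⟩, c, e⟩
      have a' : 0 < k := by omega
      exact ⟨⟨⟨a, b⟩, c⟩, ⟨Nat.pos_of_dvd_of_pos c a', (Nat.le_of_dvd a' c).trans b⟩⟩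
    · rintro ⟨⟨⟨a, b⟩, c⟩, _⟩
      exact ⟨⟨a, b⟩, c, by omega⟩

lemma tail_count (T Y : ℝ) (hT : 0 < T) (n : ℕ) :
    (((Finset.Ioc ⌊T⌋₊ n).filter (fun k : ℕ => (k : ℝ) * Nat.totient k ≤ Y ^ 2)).card : ℝ)
      ≤ Y ^ 2 * (2 * (∑' d, WW d) / T) := by
  refine le_trans ?_ (mul_le_mul_of_nonneg_left (tail_sum T hT n) (sq_nonneg Y))
  rw [Finset.mul_sum]
  refine le_trans ?_ (Finset.sum_le_sum_of_subset_of_nonneg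
    (Finset.filter_subset (fun k : ℕ => (k : ℝ) * Nat.totient k ≤ Y ^ 2) _)
    (fun _ _ _ => mul_nonneg (sq_nonneg Y) (WW_nonneg _)))
  rw [Finset.card_eq_sum_ones, Nat.cast_sum]
  apply Finset.sum_le_sum
  intro k hk
  rw [Finset.mem_filter, Finset.mem_Ioc] at hk
  have hk0 : 0 < k := by omega
  have hk0' : (0 : ℝ) < k := by exact_mod_cast hk0
  have hφ : (0 : ℝ) < Nat.totient k := by exact_mod_cast Nat.totient_pos.2 hk0
  unfold WW
  rw [Nat.cast_one, mul_one_div, le_div_iff₀ (by positivity)]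
  linarith [hk.2]

def NN (Y : ℝ) : Set ℕ := {k : ℕ | 0 < k ∧ (k : ℝ) * Nat.totient k ≤ Y ^ 2}
def NS (z : ℕ) (Y : ℝ) : Set ℕ := {k : ℕ | 0 < k ∧ (k : ℝ) ≤ Y * Real.sqrt (FS z k)}

lemma NN_sub (Y : ℝ) : NN Y ⊆ (Finset.Ioc 0 ⌊Y ^ 2⌋₊ : Finset ℕ) := by
  rintro k ⟨hk, h⟩
  rw [Finset.coe_Ioc]
  refine ⟨hk, Nat.le_floor (le_trans ?_ h)⟩
  have hφ : (1 : ℝ) ≤ Nat.totient k := by exact_mod_cast Nat.totient_pos.2 hk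
  exact le_mul_of_one_le_right (Nat.cast_nonneg k) hφ

lemma NN_fin (Y : ℝ) : (NN Y).Finite := (Finset.finite_toSet _).subset (NN_sub Y)

lemma mem_NN_iff (z k : ℕ) (Y : ℝ) (hY : 0 ≤ Y) :
    k ∈ NN Y ↔ 0 < k ∧ (k : ℝ) ≤ Y * Real.sqrt (FS z k * RR z k) := by
  unfold NN
  rw [Set.mem_ofPred_eq]
  apply and_congr_right
  intro hk
  rw [← F_eq z k hk]
  have hk0' : (0 : ℝ) < k := by exact_mod_cast hk
  have hφ : (0 : ℝ) < Nat.totient k := by exact_mod_cast Nat.totient_pos.2 hk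
  rw [← pow_le_pow_iff_left₀ (a := (k : ℝ)) (Nat.cast_nonneg k) (by positivity) two_ne_zero, mul_pow,
    Real.sq_sqrt (by positivity), mul_div_assoc', le_div_iff₀ hφ, sq (k : ℝ),
    mul_comm (Y ^ 2), mul_assoc]
  exact (mul_le_mul_iff_right₀ hk0').symm

lemma NS_sub_NN (z : ℕ) (Y : ℝ) (hY : 0 ≤ Y) : NS z Y ⊆ NN Y := by
  rintro k ⟨hk, h⟩
  rw [mem_NN_iff z k Y hY]
  refine ⟨hk, h.trans ?_⟩
  apply mul_le_mul_of_nonneg_left _ hY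
  apply Real.sqrt_le_sqrt
  exact le_mul_of_one_le_right (zero_le_one.trans (FS_ge z k)) (RR_ge z k)

lemma NS_fin (z : ℕ) (Y : ℝ) (hY : 0 ≤ Y) : (NS z Y).Finite :=
  (NN_fin Y).subset (NS_sub_NN z Y hY)

lemma upper (z : ℕ) (Y ε K : ℝ) (hY : 0 < Y) (hε : 0 < ε) (hK : 0 < K) :
    ((NN Y).ncard : ℝ) ≤ (NS z ((1 + ε) * Y)).ncard + K * Y * dl z / ε
      + 2 * (∑' d, WW d) / K * Y := by
  set B := (Finset.Ioc 0 ⌊K * Y⌋₊).filter (fun k => 1 + ε ≤ RR z k) with hB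
  set C := (Finset.Ioc ⌊K * Y⌋₊ ⌊Y ^ 2⌋₊).filter
    (fun k : ℕ => (k : ℝ) * Nat.totient k ≤ Y ^ 2) with hC
  have hsub : NN Y ⊆ (NS z ((1 + ε) * Y) ∪ (B : Set ℕ)) ∪ (C : Set ℕ) := by
    intro k hk
    have hk1 := NN_sub Y hk
    rw [Finset.coe_Ioc] at hk1
    by_cases hc : k ≤ ⌊K * Y⌋₊
    · left
      by_cases hb : 1 + ε ≤ RR z k
      · right
        rw [hB, Finset.mem_coe, Finset.mem_filter, Finset.mem_Ioc]
        exact ⟨⟨hk1.1, hc⟩, hb⟩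
      · left
        refine ⟨hk1.1, ((mem_NN_iff z k Y hY.le).1 hk).2.trans ?_⟩
        have hF := FS_ge z k
        have h1 : Real.sqrt (FS z k * RR z k) ≤ Real.sqrt ((1 + ε) ^ 2 * FS z k) := by
          apply Real.sqrt_le_sqrt
          have : RR z k ≤ (1 + ε) ^ 2 := by nlinarith
          nlinarith
        rw [Real.sqrt_mul (x := (1 + ε) ^ 2) (by positivity), Real.sqrt_sq (by positivity)] at h1
        calc Y * Real.sqrt (FS z k * RR z k) ≤ Y * ((1 + ε) * Real.sqrt (FS z k)) := by gcongr
          _ = _ := by ring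
    · right
      rw [hC, Finset.mem_coe, Finset.mem_filter, Finset.mem_Ioc]
      exact ⟨⟨by omega, hk1.2⟩, hk.2⟩
  have hfin := NS_fin z ((1 + ε) * Y) (by positivity)
  have h1 := Set.ncard_le_ncard hsub
    ((hfin.union B.finite_toSet).union C.finite_toSet)
  have h2 : (NN Y).ncard ≤ (NS z ((1 + ε) * Y)).ncard + B.card + C.card := by
    refine h1.trans ((Set.ncard_union_le _ _).trans ?_)
    rw [Set.ncard_coe_finset]
    gcongr
    refine (Set.ncard_union_le _ _).trans ?_
    rw [Set.ncard_coe_finset]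
  have h3 : ((NN Y).ncard : ℝ) ≤ (NS z ((1 + ε) * Y)).ncard + B.card + C.card := by
    exact_mod_cast h2
  have hdl : 0 ≤ dl z := by simpa using sum_le_dl z ∅ (by simp)
  have h4 : (B.card : ℝ) ≤ K * Y * dl z / ε := by
    rw [le_div_iff₀ hε]
    refine (bad_count z ⌊K * Y⌋₊ ε).trans ?_
    gcongr
    exact Nat.floor_le (by positivity)
  have h5 : (C.card : ℝ) ≤ 2 * (∑' d, WW d) / K * Y := by
    refine (tail_count (K * Y) Y (by positivity) _).trans (le_of_eq ?_)
    field_simp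
  linarith

lemma cnt_bound (P n a : ℕ) (hP : 0 < P) :
    |((((Finset.Ioc 0 n).filter (fun k => k ≡ a [MOD P])).card : ℕ) : ℝ) - n / P| ≤ 1 := by
  have h := Nat.Ioc_filter_modEq_card 0 n hP a
  have hP' : (0 : ℚ) < P := by exact_mod_cast hP
  set c := ((Finset.Ioc 0 n).filter (fun k => k ≡ a [MOD P])).card with hc
  set u := ⌊((n : ℚ) - a) / P⌋ with hu
  set v := ⌊(((0 : ℕ) : ℚ) - a) / P⌋ with hv
  have hvu : v ≤ u := by
    apply Int.floor_le_floor
    gcongr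
    simp
  have hcu : (c : ℤ) = u - v := by rw [h, max_eq_left]; linarith
  have h1 := Int.floor_le (((n : ℚ) - a) / P)
  have h2 := Int.lt_floor_add_one (((n : ℚ) - a) / P)
  have h3 := Int.floor_le ((((0 : ℕ) : ℚ) - a) / P)
  have h4 := Int.lt_floor_add_one ((((0 : ℕ) : ℚ) - a) / P)
  rw [← hu] at h1 h2
  rw [← hv] at h3 h4
  have hcq : (c : ℚ) = u - v := by exact_mod_cast hcu
  have hq : |(c : ℚ) - n / P| ≤ 1 := by
    rw [sub_div] at h1 h2 h3 h4
    rw [Nat.cast_zero, zero_div] at h3 h4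
    rw [abs_le, hcq]
    constructor <;> linarith
  have hr : (((|(c : ℚ) - n / P| : ℚ)) : ℝ) ≤ ((1 : ℚ) : ℝ) := Rat.cast_le.2 hq
  push_cast at hr
  exact hr

/-- period -/
def PP (z : ℕ) : ℕ := ∏ p ∈ Nat.primesBelow z, p

lemma PP_pos (z : ℕ) : 0 < PP z :=
  Finset.prod_pos fun _ hp => (Nat.prime_of_mem_primesBelow hp).pos

lemma FS_congr (z k a : ℕ) (h : k ≡ a [MOD PP z]) : FS z k = FS z a := by
  unfold FS
  apply Finset.prod_congr rfl
  intro p hp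
  have hd : p ∣ PP z := Finset.dvd_prod_of_mem _ hp
  have := (h.of_dvd hd).dvd_iff (dvd_refl p)
  simp only [this]

lemma NS_card (z : ℕ) (Y : ℝ) (hY : 0 ≤ Y) :
    (NS z Y).ncard = ∑ a ∈ Finset.range (PP z),
      ((Finset.Ioc 0 ⌊Y * Real.sqrt (FS z a)⌋₊).filter (fun k => k ≡ a [MOD PP z])).card := by
  rw [Set.ncard_eq_toFinset_card _ (NS_fin z Y hY)]
  rw [Finset.card_eq_sum_card_fiberwise (f := fun k => k % PP z) (t := Finset.range (PP z))]
  · apply Finset.sum_congr rfl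
    intro a ha
    have ha' : a % PP z = a := Nat.mod_eq_of_lt (Finset.mem_range.1 ha)
    congr 1
    ext k
    simp only [Finset.mem_filter, Set.Finite.mem_toFinset, Finset.mem_Ioc]
    unfold NS
    rw [Set.mem_ofPred_eq, Nat.le_floor_iff (by positivity)]
    have e : k % PP z = a ↔ k ≡ a [MOD PP z] := by rw [Nat.ModEq, ha']
    rw [e]
    apply and_congr_left
    intro h
    rw [FS_congr z k a h]
  · intro k _
    exact Finset.mem_coe.2 (Finset.mem_range.2 (Nat.mod_lt _ (PP_pos z)))

noncomputable def MM (z : ℕ) : ℝ := (∑ a ∈ Finset.range (PP z), Real.sqrt (FS z a)) / PP z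

lemma NS_bound (z : ℕ) (Y : ℝ) (hY : 0 ≤ Y) :
    |((NS z Y).ncard : ℝ) - Y * MM z| ≤ 2 * PP z := by
  have hP : (1 : ℝ) ≤ PP z := by exact_mod_cast PP_pos z
  rw [NS_card z Y hY, MM, Nat.cast_sum, Finset.sum_div, Finset.mul_sum,
    ← Finset.sum_sub_distrib]
  refine (Finset.abs_sum_le_sum_abs _ _).trans ?_
  have : ∑ a ∈ Finset.range (PP z), (2 : ℝ) = 2 * PP z := by simp [mul_comm]
  rw [← this]
  apply Finset.sum_le_sum
  intro a _
  have h1 := cnt_bound (PP z) ⌊Y * Real.sqrt (FS z a)⌋₊ a (PP_pos z)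
  have h0 : 0 ≤ Y * Real.sqrt (FS z a) := by positivity
  have h2 := Nat.floor_le h0
  have h3 := Nat.lt_floor_add_one (Y * Real.sqrt (FS z a))
  have h4 : |(⌊Y * Real.sqrt (FS z a)⌋₊ : ℝ) / PP z - Y * (Real.sqrt (FS z a) / PP z)| ≤ 1 := by
    rw [mul_div_assoc', ← sub_div, abs_div, abs_of_pos (by linarith : (0 : ℝ) < PP z)]
    rw [div_le_one (by linarith)]
    refine le_trans ?_ hP
    rw [abs_le]; constructor <;> linarith
  have := abs_add_le _ _ |>.trans (add_le_add h1 h4)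
  rw [sub_add_sub_cancel] at this
  linarith

lemma NS_tendsto (z : ℕ) : Tendsto (fun Y : ℝ => ((NS z Y).ncard : ℝ) / Y) atTop (𝓝 (MM z)) := by
  have h : Tendsto (fun Y : ℝ => 2 * (PP z : ℝ) / Y) atTop (𝓝 0) :=
    tendsto_const_nhds.div_atTop tendsto_id
  rw [tendsto_iff_dist_tendsto_zero]
  refine squeeze_zero' (Eventually.of_forall fun _ => dist_nonneg) ?_ h
  filter_upwards [eventually_gt_atTop 0] with Y hY
  have := NS_bound z Y hY.le
  rw [Real.dist_eq, le_div_iff₀ hY]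
  calc _ = |((NS z Y).ncard : ℝ) / Y - MM z| * |Y| := by rw [abs_of_pos hY]
    _ = |((NS z Y).ncard : ℝ) - Y * MM z| := by
      rw [← abs_mul]; congr 1; field_simp
    _ ≤ _ := this

noncomputable def uu (p : ℕ) : ℝ :=
  1 / ((p : ℝ) * ((p : ℝ) - 1 + Real.sqrt ((p : ℝ) ^ 2 - (p : ℝ))))

lemma uu_eq (p : ℕ) (hp : p.Prime) : (Real.sqrt (rr p) - 1) / p = uu p := by
  have h2 : (2 : ℝ) ≤ p := by exact_mod_cast hp.two_le
  have e : rr p = ((p : ℝ) ^ 2 - p) / (p - 1) ^ 2 := by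
    unfold rr
    have : (p : ℝ) - 1 ≠ 0 := by linarith
    field_simp
    ring
  have hpos : 0 < (p : ℝ) ^ 2 - p := by nlinarith
  rw [e, Real.sqrt_div hpos.le, Real.sqrt_sq (by linarith)]
  unfold uu
  have hs := Real.sq_sqrt hpos.le
  have hs0 := Real.sqrt_nonneg ((p : ℝ) ^ 2 - p)
  set s := Real.sqrt ((p : ℝ) ^ 2 - p)
  have h1 : (p : ℝ) - 1 ≠ 0 := by linarith
  have h3 : (p : ℝ) - 1 + s ≠ 0 := by linarith
  have h4 : (p : ℝ) ≠ 0 := by linarith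
  field_simp
  nlinarith

lemma card_mult (d e : ℕ) (hd : 0 < d) :
    ((Finset.range (d * e)).filter (fun a => d ∣ a)).card = e := by
  have : (Finset.range (d * e)).filter (fun a => d ∣ a)
      = (Finset.range e).image (fun m => d * m) := by
    ext a
    simp only [Finset.mem_filter, Finset.mem_range, Finset.mem_image]
    constructor
    · rintro ⟨h, m, rfl⟩; exact ⟨m, lt_of_mul_lt_mul_left' h, rfl⟩
    · rintro ⟨m, h, rfl⟩; exact ⟨Nat.mul_lt_mul_of_pos_left h hd, dvd_mul_right _ _⟩
  rw [this, Finset.card_image_of_injective _ (fun a b h => Nat.eq_of_mul_eq_mul_left hd h),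
    Finset.card_range]

lemma MM_eq (z : ℕ) : MM z = ∏ p ∈ Nat.primesBelow z, (1 + uu p) := by
  have hpr : ∀ p ∈ Nat.primesBelow z, p.Prime := fun p hp => Nat.prime_of_mem_primesBelow hp
  have h1 : ∀ a, Real.sqrt (FS z a) = ∑ t ∈ (Nat.primesBelow z).powerset,
      if (∏ p ∈ t, p) ∣ a then ∏ p ∈ t, (Real.sqrt (rr p) - 1) else 0 := by
    intro a
    have : Real.sqrt (FS z a) = ∏ p ∈ Nat.primesBelow z,
        (1 + if p ∣ a then Real.sqrt (rr p) - 1 else 0) := by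
      unfold FS
      rw [Real.sqrt_prod]
      · apply Finset.prod_congr rfl
        intro p _
        split_ifs <;> simp
      · intro p hp
        have := rr_ge p (hpr p hp)
        split_ifs <;> linarith
    rw [this, Finset.prod_one_add]
    apply Finset.sum_congr rfl
    intro t ht
    have htp : ∀ p ∈ t, p.Prime := fun p hp => hpr p (Finset.mem_powerset.1 ht hp)
    have hdvd : (∏ p ∈ t, p) ∣ a ↔ ∀ p ∈ t, p ∣ a := by
      constructor
      · intro h p hp; exact (Finset.dvd_prod_of_mem _ hp).trans h
      · intro h
        exact Finset.prod_primes_dvd a (fun p hp => (htp p hp).prime) h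
    by_cases h : ∀ p ∈ t, p ∣ a
    · rw [if_pos (hdvd.2 h)]
      exact Finset.prod_congr rfl fun p hp => if_pos (h p hp)
    · rw [if_neg (fun h' => h (hdvd.1 h'))]
      push Not at h
      obtain ⟨p, hp, hpa⟩ := h
      exact Finset.prod_eq_zero hp (if_neg hpa)
  have hP : (PP z : ℝ) ≠ 0 := by exact_mod_cast (PP_pos z).ne'
  unfold MM
  rw [Finset.sum_congr rfl (fun a _ => h1 a), Finset.sum_comm, Finset.prod_one_add,
    Finset.sum_div]
  apply Finset.sum_congr rfl
  intro t ht
  have htp : ∀ p ∈ t, p.Prime := fun p hp => hpr p (Finset.mem_powerset.1 ht hp)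
  have h0 : 0 < ∏ p ∈ t, p := Finset.prod_pos fun p hp => (htp p hp).pos
  obtain ⟨e, he⟩ : (∏ p ∈ t, p) ∣ PP z :=
    Finset.prod_dvd_prod_of_subset _ _ _ (Finset.mem_powerset.1 ht)
  rw [← Finset.sum_filter, Finset.sum_const, he, card_mult _ _ h0, nsmul_eq_mul]
  rw [← Finset.prod_congr rfl (fun p hp => uu_eq p (htp p hp)), Finset.prod_div_distrib]
  have he0 : (e : ℝ) ≠ 0 := by
    rintro h
    rw [he] at hP
    push_cast at hP
    rw [h, mul_zero] at hP
    exact hP rfl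
  have h0' : (∏ p ∈ t, (p : ℝ)) ≠ 0 := by
    rw [← Nat.cast_prod]
    exact Nat.cast_ne_zero.2 h0.ne'
  push_cast
  field_simp

lemma uu_bound (p : ℕ) (hp : p.Prime) : 0 ≤ uu p ∧ uu p ≤ WW p := by
  have h2 : (2 : ℝ) ≤ p := by exact_mod_cast hp.two_le
  have hs0 := Real.sqrt_nonneg ((p : ℝ) ^ 2 - p)
  unfold uu WW
  rw [Nat.totient_prime hp, Nat.cast_sub hp.one_le, Nat.cast_one]
  constructor
  · apply div_nonneg zero_le_one
    apply mul_nonneg <;> linarith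
  · apply one_div_le_one_div_of_le
    · apply mul_pos <;> linarith
    · apply mul_le_mul_of_nonneg_left <;> linarith

lemma MM_tendsto : Tendsto MM atTop (𝓝 (∏' p : Nat.Primes, (1 + uu p))) := by
  set s : Set ℕ := {p | p.Prime}
  have hsum : Summable (s.indicator uu) := by
    refine Summable.of_nonneg_of_le ?_ ?_ WW_summable
    · intro p
      exact Set.indicator_nonneg (fun p hp => (uu_bound p hp).1) p
    · intro p
      exact Set.indicator_le' (fun p hp => (uu_bound p hp).2) (fun p _ => WW_nonneg p) p
  have hmul := Real.multipliable_one_add_of_summable hsum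
  have e : (fun p => 1 + s.indicator uu p) = s.mulIndicator (fun p => 1 + uu p) := by
    funext p
    by_cases hp : p ∈ s <;> simp [hp]
  rw [e] at hmul
  have h1 : ∏' p : Nat.Primes, (1 + uu p) = ∏' p, s.mulIndicator (fun p => 1 + uu p) p :=
    tprod_subtype s (fun p => 1 + uu p)
  rw [h1]
  have h2 := hmul.hasProd.tendsto_prod_nat
  refine h2.congr fun z => ?_
  rw [MM_eq, Nat.primesBelow, Finset.prod_filter]
  apply Finset.prod_congr rfl
  intro p _
  rw [Set.mulIndicator_apply]
  rfl

lemma NN_tendsto : Tendsto (fun Y : ℝ => ((NN Y).ncard : ℝ) / Y) atTop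
    (𝓝 (∏' p : Nat.Primes, (1 + uu p))) := by
  set M := ∏' p : Nat.Primes, (1 + uu p)
  set C := 2 * ∑' d, WW d with hCdef
  rw [tendsto_order]
  constructor
  · intro a ha
    obtain ⟨z, hz⟩ := ((tendsto_order.1 MM_tendsto).1 a ha).exists
    filter_upwards [(tendsto_order.1 (NS_tendsto z)).1 a hz, eventually_gt_atTop 0] with Y h1 hY
    refine h1.trans_le ?_
    have := Set.ncard_le_ncard (NS_sub_NN z Y hY.le) (NN_fin Y)
    gcongr
  · intro b hb
    have hK : Tendsto (fun K : ℝ => (1 + 1 / K) * M + C / K) atTop (𝓝 M) := by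
      have h1 : Tendsto (fun K : ℝ => 1 / K) atTop (𝓝 0) :=
        tendsto_const_nhds.div_atTop tendsto_id
      have h2 : Tendsto (fun K : ℝ => C / K) atTop (𝓝 0) :=
        tendsto_const_nhds.div_atTop tendsto_id
      have := ((h1.const_add 1).mul_const M).add h2
      simpa using this
    obtain ⟨K, hKb, hK0⟩ := (((tendsto_order.1 hK).2 b hb).and (eventually_gt_atTop 0)).exists
    have hz : Tendsto (fun z => (1 + 1 / K) * MM z + K * dl z / (1 / K) + C / K) atTop
        (𝓝 ((1 + 1 / K) * M + C / K)) := by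
      have := ((MM_tendsto.const_mul (1 + 1 / K)).add
        ((dl_tendsto.const_mul K).div_const (1 / K))).add_const (C / K)
      simpa using this
    obtain ⟨z, hzb⟩ := ((tendsto_order.1 hz).2 b hKb).exists
    have hε : 0 < 1 / K := by positivity
    have hlim : Tendsto (fun Y : ℝ => (1 + 1 / K) *
        (((NS z ((1 + 1 / K) * Y)).ncard : ℝ) / ((1 + 1 / K) * Y))
        + K * dl z / (1 / K) + C / K) atTop
        (𝓝 ((1 + 1 / K) * MM z + K * dl z / (1 / K) + C / K)) := by
      have h := (NS_tendsto z).comp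
        (tendsto_id.const_mul_atTop (by positivity : (0 : ℝ) < 1 + 1 / K))
      exact ((h.const_mul _).add_const _).add_const _
    filter_upwards [(tendsto_order.1 hlim).2 b hzb, eventually_gt_atTop 0] with Y h1 hY
    refine lt_of_le_of_lt ?_ h1
    rw [div_le_iff₀ hY]
    refine (upper z Y (1 / K) K hY hε hK0).trans (le_of_eq ?_)
    have : (1 + 1 / K) ≠ 0 := by positivity
    rw [← hCdef]
    generalize ((NS z ((1 + 1 / K) * Y)).ncard : ℝ) = N
    generalize (1 + 1 / K) = c at *
    field_simp

/-- With φ_X := #{n ≤ X : n = k·φ(k) for some positive integer k}, where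
φ is Euler's totient function, one has φ_X = c·X^{1/2} + o(X^{1/2}) as X → ∞, where
c = ∏_p (1 + 1/(p(p − 1 + √(p² − p)))) over all primes p; i.e. φ_X / √X → c. -/
theorem stmt_18 :
    Tendsto (fun X : ℝ =>
      (({n : ℕ | 0 < n ∧ (n : ℝ) ≤ X ∧
          ∃ k : ℕ, 0 < k ∧ n = k * Nat.totient k}.ncard : ℝ)) / Real.sqrt X) atTop
      (𝓝 (∏' p : Nat.Primes,
        (1 + 1 / ((p : ℝ) * ((p : ℝ) - 1 + Real.sqrt ((p : ℝ) ^ 2 - (p : ℝ))))))) := by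
  have h := NN_tendsto.comp Real.tendsto_sqrt_atTop
  refine h.congr' ?_
  filter_upwards [eventually_ge_atTop 0] with X hX
  simp only [Function.comp]
  congr 2
  have e : {n : ℕ | 0 < n ∧ (n : ℝ) ≤ X ∧ ∃ k : ℕ, 0 < k ∧ n = k * Nat.totient k}
      = (fun k => k * Nat.totient k) '' NN (Real.sqrt X) := by
    ext n
    simp only [Set.mem_image, NN, Set.mem_ofPred_eq, Real.sq_sqrt hX]
    constructor
    · rintro ⟨_, h2, k, hk, rfl⟩
      push_cast at h2
      exact ⟨k, ⟨hk, h2⟩, rfl⟩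
    · rintro ⟨k, ⟨hk, h2⟩, rfl⟩
      refine ⟨Nat.mul_pos hk (Nat.totient_pos.2 hk), by push_cast; exact h2, k, hk, rfl⟩
  rw [e, Set.ncard_image_of_injOn]
  intro k hk m hm h
  exact aux_inj k m hk.1 hm.1 h
end
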